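/- arXiv:2008.09467 — 3 statements merged into one kernel-verified Lean document; each statement's English description precedes it below -/
import Mathlib

section
/- For every integer k ≥ 3, setting n = 2k², there exists a cubic graph on n vertices that has a polyhedral embedding of genus 1 and a polyhedral embedding of genus (k² − 3k + 2)/2 = n/4 − (3/2)√(n/2) + 1, and that, up to mirror images, has no polyhedral embedding other than these. -/
open SimpleGraph

/-- A graph is cubic if every vertex has degree `3`. -/
def SimpleGraph.IsCubic {V : Type*} (G : SimpleGraph V) : Prop :=
  ∀ v : V, Nat.card (G.neighborSet v) = 3

/-- A combinatorial (orientable) embedding of a graph `G`, given as a rotation system: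
a permutation of the darts of `G` whose orbits are exactly the sets of darts
sharing a common tail. -/
structure RotationSystem {V : Type*} [Fintype V] [DecidableEq V] (G : SimpleGraph V) where
  σ : Equiv.Perm G.Dart
  tail_fixed : ∀ d : G.Dart, (σ d).fst = d.fst
  orbit_tail : ∀ d d' : G.Dart, d.fst = d'.fst → σ.SameCycle d d'

namespace RotationSystem

variable {V : Type*} [Fintype V] [DecidableEq V] {G : SimpleGraph V}

/-- The involutive permutation of darts reversing the orientation. -/
def dartSymmPerm (G : SimpleGraph V) : Equiv.Perm G.Dart :=
  ⟨SimpleGraph.Dart.symm, SimpleGraph.Dart.symm,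
    fun d => d.symm_symm, fun d => d.symm_symm⟩

/-- The permutation sending a dart `d` to `σ (d⁻¹)`; its orbits are the faces
of the embedding. -/
def faceMap (R : RotationSystem G) : Equiv.Perm G.Dart :=
  (dartSymmPerm G).trans R.σ

/-- Two darts lie on the same face iff they are in the same orbit of the face map. -/
def SameFace (R : RotationSystem G) : G.Dart → G.Dart → Prop :=
  (R.faceMap).SameCycle

/-- The set of vertices of the face (of the embedding `R`) containing the dart `d`. -/
def faceVerts (R : RotationSystem G) (d : G.Dart) : Set V :=
  {v | ∃ d' : G.Dart, R.SameFace d d' ∧ d'.fst = v}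

/-- The set of edges of the face (of the embedding `R`) containing the dart `d`. -/
def faceEdges (R : RotationSystem G) (d : G.Dart) : Set (Sym2 V) :=
  {e | ∃ d' : G.Dart, R.SameFace d d' ∧ d'.edge = e}

/-- Every facial walk of the embedding is a simple cycle, i.e. no facial walk
visits a vertex twice. -/
def FacesSimple (R : RotationSystem G) : Prop :=
  ∀ d d' : G.Dart, R.SameFace d d' → d.fst = d'.fst → d = d'

/-- An embedding is polyhedral if every facial walk is a simple cycle and the
intersection of any two distinct faces (as subgraphs) is empty, a single vertex,
or a single edge. -/
def Polyhedral (R : RotationSystem G) : Prop :=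
  R.FacesSimple ∧
  ∀ d d' : G.Dart, ¬ R.SameFace d d' →
    (R.faceVerts d ∩ R.faceVerts d' = ∅) ∨
    (∃ v : V, R.faceVerts d ∩ R.faceVerts d' = {v} ∧
      R.faceEdges d ∩ R.faceEdges d' = ∅) ∨
    (∃ u w : V, G.Adj u w ∧ R.faceVerts d ∩ R.faceVerts d' = {u, w} ∧
      R.faceEdges d ∩ R.faceEdges d' = {s(u, w)})

/-- The number of faces of the embedding. -/
noncomputable def numFaces (R : RotationSystem G) : ℕ :=
  Nat.card (Quot R.SameFace)

/-- The embedding has genus `g`, defined via Euler's formula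
`|V| - |E| + F = 2 - 2g`. -/
def HasGenus (R : RotationSystem G) (g : ℕ) : Prop :=
  (Fintype.card V : ℤ) - Nat.card G.edgeSet + R.numFaces = 2 - 2 * (g : ℤ)

end RotationSystem

namespace TorusHex

/-- Vertices of the `k × k` toroidal hexagonal grid: `(false, i, j)` is black, `(true, i, j)` white. -/
abbrev Vt (k : ℕ) := Bool × ZMod k × ZMod k

/-- Darts are pairs (tail, colour). -/
abbrev Dt (k : ℕ) := Vt k × Fin 3

def oi (c : Fin 3) : ℤ := if c = 1 then 1 else 0
def oj (c : Fin 3) : ℤ := if c = 2 then 1 else 0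

variable {k : ℕ}

/-- The neighbour of `v` along the edge of colour `c`. -/
def nb (v : Vt k) (c : Fin 3) : Vt k :=
  if v.1 then (false, v.2.1 - (oi c : ℤ), v.2.2 - (oj c : ℤ))
  else (true, v.2.1 + (oi c : ℤ), v.2.2 + (oj c : ℤ))

lemma nb_nb (v : Vt k) (c : Fin 3) : nb (nb v c) c = v := by
  obtain ⟨t, i, j⟩ := v
  cases t <;> simp [nb]

/-- Reversal of darts. -/
def inv : Equiv.Perm (Dt k) where
  toFun d := (nb d.1 d.2, d.2)
  invFun d := (nb d.1 d.2, d.2)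
  left_inv d := by simp [nb_nb]
  right_inv d := by simp [nb_nb]

lemma inv_apply (d : Dt k) : inv d = (nb d.1 d.2, d.2) := rfl

lemma inv_inv (d : Dt k) : inv (inv d) = d := by simp [inv_apply, nb_nb]

/-- The rotation described by a choice of signs `ε`. -/
def rotc (ε : Vt k → Bool) : Equiv.Perm (Dt k) where
  toFun d := (d.1, if ε d.1 then d.2 + 1 else d.2 - 1)
  invFun d := (d.1, if ε d.1 then d.2 - 1 else d.2 + 1)
  left_inv d := by
    obtain ⟨v, c⟩ := d
    by_cases h : ε v <;> simp [h]
  right_inv d := by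
    obtain ⟨v, c⟩ := d
    by_cases h : ε v <;> simp [h]

/-- The face permutation. -/
def Fm (ε : Vt k → Bool) : Equiv.Perm (Dt k) := inv.trans (rotc ε)

lemma Fm_apply (ε : Vt k → Bool) (d : Dt k) :
    Fm ε d = (nb d.1 d.2, if ε (nb d.1 d.2) then d.2 + 1 else d.2 - 1) := rfl

/-- The combinatorial form of polyhedrality. -/
def Good (ε : Vt k → Bool) : Prop :=
  (∀ d, ¬ (Fm ε).SameCycle d (inv d)) ∧
  ∀ x y, (Fm ε).SameCycle x y → (Fm ε).SameCycle (inv x) (inv y) → x = y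

lemma sameCycle_transfer {α β : Type*} (f : Equiv.Perm α) (g : Equiv.Perm β) (φ : α ≃ β)
    (h : ∀ x, φ (f x) = g (φ x)) (x y : α) :
    f.SameCycle x y ↔ g.SameCycle (φ x) (φ y) := by
  have hg : g = φ.permCongrHom f := by
    ext b
    simp [Equiv.permCongrHom, h]
  have key : ∀ n : ℤ, (g ^ n) (φ x) = φ ((f ^ n) x) := by
    intro n
    rw [hg, ← map_zpow]
    simp [Equiv.permCongrHom]
  simp only [Equiv.Perm.SameCycle, key, φ.injective.eq_iff]

/-- Colour-shifting automorphisms of the grid preserve goodness. -/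
lemma Good.comp {ε : Vt k → Bool} (h : Good ε) (g : Vt k ≃ Vt k) (s : Fin 3)
    (hg : ∀ v c, nb (g v) (c + s) = g (nb v c)) : Good (ε ∘ g) := by
  let ψ : Dt k ≃ Dt k := Equiv.prodCongr g (Equiv.addRight s)
  have hψ : ∀ v c, ψ (v, c) = (g v, c + s) := fun _ _ => rfl
  have h1 : ∀ x, ψ (Fm (ε ∘ g) x) = Fm ε (ψ x) := by
    rintro ⟨v, c⟩
    simp only [Fm_apply, hψ, hg, Function.comp]
    split_ifs <;> simp <;> abel
  have h2 : ∀ x, ψ (inv x) = inv (ψ x) := by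
    rintro ⟨v, c⟩
    simp only [inv_apply, hψ, hg]
  have h3 := sameCycle_transfer _ _ ψ h1
  refine ⟨fun d hd => h.1 (ψ d) ?_, fun x y hx hy => ψ.injective (h.2 _ _ ?_ ?_)⟩
  · rw [← h2, ← h3]; exact hd
  · rw [← h3]; exact hx
  · rw [← h2, ← h2, ← h3]; exact hy

/-- Mirror images preserve goodness. -/
lemma Good.neg {ε : Vt k → Bool} (h : Good ε) : Good (fun v => !ε v) := by
  have h1 : ∀ x, inv (Fm (fun v => !ε v) x) = (Fm ε)⁻¹ (inv x) := by
    intro x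
    rw [Equiv.Perm.eq_inv_iff_eq]
    obtain ⟨v, c⟩ := x
    by_cases hh : ε (nb v c) <;> simp [Fm_apply, inv_apply, nb_nb, hh]
  have h3 : ∀ x y, (Fm (fun v => !ε v)).SameCycle x y ↔ (Fm ε).SameCycle (inv x) (inv y) := by
    intro x y
    rw [sameCycle_transfer _ _ inv h1, Equiv.Perm.sameCycle_inv]
  refine ⟨fun d hd => h.1 (inv d) ?_, fun x y hx hy => h.2 _ _ ?_ ?_⟩
  · rwa [h3] at hd
  · rw [h3, inv_inv, inv_inv] at hy; exact hy
  · rwa [h3] at hx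

/-! ### The certificate checker -/

/-- Vertices and darts of the universal cover. -/
abbrev ZV := Bool × ℤ × ℤ
abbrev ZD := ZV × Fin 3

def znb (v : ZV) (c : Fin 3) : ZV :=
  if v.1 then (false, v.2.1 - oi c, v.2.2 - oj c) else (true, v.2.1 + oi c, v.2.2 + oj c)

def zinv (d : ZD) : ZD := (znb d.1 d.2, d.2)

/-- Partial sign assignments. -/
abbrev Asg := List (ZV × Bool)

def look : Asg → ZV → Option Bool
  | [], _ => none
  | (w, b) :: a, v => if w = v then some b else look a v

def zstep (a : Asg) (d : ZD) : Option ZD :=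
  match look a (znb d.1 d.2) with
  | none => none
  | some b => some (znb d.1 d.2, if b then d.2 + 1 else d.2 - 1)

def zrun (a : Asg) : ℕ → ZD → Option ZD
  | 0, d => some d
  | n + 1, d =>
    match zstep a d with
    | none => none
    | some dd => zrun a n dd

/-- An integer that is not divisible by any `k ≥ 3`. -/
def small (z : ℤ) : Bool := z = 1 || z = -1 || z = 2 || z = -2

/-- A test guaranteeing that two darts of the cover have different images in the torus. -/
def apart (x y : ZD) : Bool :=
  (x.1.1 != y.1.1) || (x.2 != y.2) || small (x.1.2.1 - y.1.2.1) || small (x.1.2.2 - y.1.2.2)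

/-- Refutation trees: case splits on the sign of a vertex, with leaves pointing at faces that
meet twice. -/
inductive T
  | S (t : Bool) (i j : ℤ) (l r : T)
  | P (t : Bool) (i j : ℤ) (c : Fin 3) (m n : ℕ)
  | Q (t : Bool) (i j : ℤ) (c : Fin 3) (m n : ℕ)
  | N (t : Bool) (i j : ℤ) (c : Fin 3) (m : ℕ)

def chk (a : Asg) : T → Bool
  | .S t i j l r => chk (((t, i, j), false) :: a) l && chk (((t, i, j), true) :: a) r
  | .P t i j c m n =>
    match zrun a m ((t, i, j), c) with
    | none => false
    | some y =>
      match zrun a n (zinv ((t, i, j), c)) with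
      | none => false
      | some z => decide (z = zinv y) && apart ((t, i, j), c) y
  | .Q t i j c m n =>
    match zrun a m ((t, i, j), c) with
    | none => false
    | some y =>
      match zrun a n (zinv y) with
      | none => false
      | some z => decide (z = zinv ((t, i, j), c)) && apart ((t, i, j), c) y
  | .N t i j c m =>
    match zrun a m ((t, i, j), c) with
    | none => false
    | some y => decide (y = zinv ((t, i, j), c))

/-- The covering map. -/
def cv (k : ℕ) (v : ZV) : Vt k := (v.1, (v.2.1 : ZMod k), (v.2.2 : ZMod k))
def cd (k : ℕ) (d : ZD) : Dt k := (cv k d.1, d.2)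

lemma cv_znb (v : ZV) (c : Fin 3) : cv k (znb v c) = nb (cv k v) c := by
  obtain ⟨t, i, j⟩ := v
  cases t <;> simp [cv, znb, nb]

lemma cd_zinv (d : ZD) : cd k (zinv d) = inv (cd k d) := by
  simp [cd, zinv, inv_apply, cv_znb]

def Cons (ε : Vt k → Bool) (a : Asg) : Prop := ∀ p ∈ a, ε (cv k p.1) = p.2

lemma look_sound {ε : Vt k → Bool} {a : Asg} (h : Cons ε a) {v : ZV} {b : Bool}
    (hl : look a v = some b) : ε (cv k v) = b := by
  induction a with
  | nil => simp [look] at hl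
  | cons p a ih =>
    obtain ⟨w, c⟩ := p
    simp only [look] at hl
    split_ifs at hl with hw
    · subst hw
      have := h (w, c) (by simp)
      simp at hl
      simpa [hl] using this
    · exact ih (fun p hp => h p (by simp [hp])) hl

lemma zstep_sound {ε : Vt k → Bool} {a : Asg} (h : Cons ε a) {d d' : ZD}
    (hl : zstep a d = some d') : cd k d' = Fm ε (cd k d) := by
  unfold zstep at hl
  split at hl
  · simp at hl
  · rename_i b hb
    have := look_sound h hb
    simp only [Option.some.injEq] at hl
    subst hl
    simp [cd, Fm_apply, ← cv_znb, this]

lemma zrun_sound {ε : Vt k → Bool} {a : Asg} (h : Cons ε a) (n : ℕ) {d d' : ZD}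
    (hl : zrun a n d = some d') : (Fm ε).SameCycle (cd k d) (cd k d') := by
  induction n generalizing d with
  | zero => simp [zrun] at hl; rw [hl]
  | succ n ih =>
    simp only [zrun] at hl
    split at hl
    · simp at hl
    · rename_i e he
      have h1 := zstep_sound h he
      have h2 := ih hl
      rw [h1] at h2
      exact (Equiv.Perm.sameCycle_apply_left).1 h2

lemma small_sound (hk : 3 ≤ k) {z : ℤ} (h : small z = true) : ((z : ℤ) : ZMod k) ≠ 0 := by
  rw [Ne, ZMod.intCast_zmod_eq_zero_iff_dvd]
  intro hd
  have hz : z = 1 ∨ z = -1 ∨ z = 2 ∨ z = -2 := by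
    simpa [small, or_assoc] using h
  have h0 : z ≠ 0 := by omega
  have := Int.le_of_dvd (abs_pos.2 h0) ((dvd_abs _ _).2 hd)
  rcases hz with rfl | rfl | rfl | rfl <;> norm_num at this <;> omega

lemma apart_sound (hk : 3 ≤ k) {x y : ZD} (h : apart x y = true) : cd k x ≠ cd k y := by
  intro he
  obtain ⟨⟨t, i, j⟩, c⟩ := x
  obtain ⟨⟨t', i', j'⟩, c'⟩ := y
  simp only [cd, cv, Prod.mk.injEq] at he
  obtain ⟨⟨h1, h2, h3⟩, h4⟩ := he
  simp only [apart, h1, h4, bne_self_eq_false, Bool.false_or, Bool.or_eq_true] at h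
  rcases h with h | h
  · exact small_sound hk h (by push_cast; rw [h2, sub_self])
  · exact small_sound hk h (by push_cast; rw [h3, sub_self])

lemma chk_sound (hk : 3 ≤ k) {ε : Vt k → Bool} (hε : Good ε) (t : T) :
    ∀ a : Asg, Cons ε a → chk a t = true → False := by
  induction t with
  | S t i j l r ihl ihr =>
    intro a ha hc
    simp only [chk, Bool.and_eq_true] at hc
    cases hb : ε (cv k (t, i, j)) with
    | false =>
      refine ihl _ ?_ hc.1
      intro p hp
      rcases List.mem_cons.1 hp with rfl | hp
      · exact hb
      · exact ha p hp
    | true =>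
      refine ihr _ ?_ hc.2
      intro p hp
      rcases List.mem_cons.1 hp with rfl | hp
      · exact hb
      · exact ha p hp
  | P t i j c m n =>
    intro a ha hc
    simp only [chk] at hc
    split at hc
    · simp at hc
    · rename_i y hy
      split at hc
      · simp at hc
      · rename_i z hz
        simp only [Bool.and_eq_true, decide_eq_true_eq] at hc
        have h1 := zrun_sound ha _ hy
        have h2 := zrun_sound ha _ hz
        rw [hc.1, cd_zinv, cd_zinv] at h2
        exact apart_sound hk hc.2 (hε.2 _ _ h1 h2)
  | Q t i j c m n =>
    intro a ha hc
    simp only [chk] at hc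
    split at hc
    · simp at hc
    · rename_i y hy
      split at hc
      · simp at hc
      · rename_i z hz
        simp only [Bool.and_eq_true, decide_eq_true_eq] at hc
        have h1 := zrun_sound ha _ hy
        have h2 := zrun_sound ha _ hz
        rw [hc.1, cd_zinv, cd_zinv] at h2
        exact apart_sound hk hc.2 (hε.2 _ _ h1 h2.symm)
  | N t i j c m =>
    intro a ha hc
    simp only [chk] at hc
    split at hc
    · simp at hc
    · rename_i y hy
      simp only [decide_eq_true_eq] at hc
      have h1 := zrun_sound ha _ hy
      rw [hc, cd_zinv] at h1
      exact hε.1 _ h1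

abbrev tt : Bool := true
abbrev ff : Bool := false

/-- The refutation tree. -/
def cert : T :=
  .S ff 4 3
  (.S tt 4 4
  (.S ff 3 4
  (.P ff 4 3 0 2 4)
  (.S ff 4 4
  (.S tt 3 3
  (.S ff 4 2
  (.S ff 3 2
  (.S tt 4 2
  (.Q ff 4 3 0 2 6)
  (.Q ff 4 1 2 6 6))
  (.S tt 4 2
  (.Q tt 3 2 0 7 5)
  (.Q ff 2 3 1 4 4)))
  (.S ff 3 2
  (.S tt 4 2
  (.P ff 3 3 0 3 3)
  (.P ff 3 3 0 2 4))
  (.S tt 4 2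
  (.Q ff 2 3 1 5 3)
  (.P ff 3 3 0 1 5))))
  (.S ff 2 4
  (.S tt 2 4
  (.S ff 2 3
  (.Q ff 3 2 2 2 6)
  (.P ff 3 3 2 3 3))
  (.S ff 2 3
  (.S tt 3 5
  (.S ff 2 5
  (.S tt 2 5
  (.P ff 3 4 2 5 1)
  (.Q ff 1 5 1 4 4))
  (.S tt 2 5
  (.Q tt 4 4 1 3 5)
  (.Q ff 3 5 0 6 6)))
  (.S ff 2 5
  (.S tt 2 5
  (.Q ff 3 5 0 6 2)
  (.Q tt 2 3 0 5 7))
  (.S tt 2 5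
  (.P ff 2 5 0 3 3)
  (.P ff 2 4 2 4 2))))
  (.Q ff 3 4 0 6 2)))
  (.S tt 2 4
  (.S ff 2 3
  (.S tt 3 5
  (.S ff 2 5
  (.S tt 2 5
  (.Q tt 2 4 0 3 5)
  (.P ff 4 3 0 5 5))
  (.S tt 2 5
  (.S ff 3 5
  (.S tt 4 5
  (.P ff 3 4 1 5 1)
  (.Q ff 4 5 0 4 4))
  (.S tt 4 5
  (.Q tt 3 4 0 5 3)
  (.S ff 1 4
  (.S ff 1 5
  (.S tt 1 5
  (.P ff 2 4 2 5 1)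
  (.Q ff 0 5 1 4 4))
  (.S tt 1 5
  (.Q tt 3 4 1 3 5)
  (.P ff 1 4 2 7 7)))
  (.S tt 2 3
  (.S ff 1 3
  (.S tt 1 4
  (.P ff 1 4 0 5 1)
  (.Q ff 0 4 1 6 2))
  (.S tt 1 4
  (.Q tt 1 3 0 5 3)
  (.P ff 1 3 1 3 3)))
  (.S ff 1 3
  (.S tt 1 4
  (.Q ff 2 2 2 4 4)
  (.Q ff 3 4 0 6 6))
  (.S tt 1 4
  (.Q ff 3 4 0 7 5)
  (.P ff 2 3 0 4 2)))))))
  (.Q ff 3 5 0 3 5)))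
  (.S tt 2 5
  (.S ff 2 5
  (.P ff 2 5 1 5 5)
  (.Q ff 1 5 1 5 3))
  (.S ff 2 5
  (.Q ff 3 3 2 4 4)
  (.P ff 2 4 1 1 5))))
  (.Q ff 3 4 0 5 3))
  (.S ff 2 3
  (.Q ff 3 4 0 4 4)
  (.N ff 3 4 0 7)))))
  (.S tt 5 3
  (.S ff 5 3
  (.S tt 5 4
  (.P ff 4 4 0 5 1)
  (.Q ff 5 4 0 2 6))
  (.S tt 5 4
  (.Q tt 6 3 1 3 5)
  (.P ff 4 4 0 3 3)))
  (.S ff 5 3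
  (.S tt 5 4
  (.Q ff 5 2 2 4 4)
  (.Q ff 2 4 1 6 6))
  (.S tt 5 4
  (.Q ff 5 4 0 7 5)
  (.P ff 4 4 0 2 4))))))
  (.S ff 3 4
  (.S ff 4 2
  (.S tt 3 3
  (.S tt 4 2
  (.S ff 3 2
  (.Q ff 4 3 0 2 6)
  (.Q ff 4 4 0 6 6))
  (.S ff 3 2
  (.Q ff 4 4 0 7 5)
  (.Q ff 2 3 1 4 4)))
  (.S tt 4 2
  (.S ff 3 2
  (.P ff 3 2 2 3 3)
  (.P ff 3 2 1 2 4))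
  (.S ff 3 2
  (.Q tt 3 2 0 5 3)
  (.P ff 4 2 0 5 1))))
  (.S tt 3 5
  (.S tt 5 3
  (.S tt 5 2
  (.S ff 5 2
  (.Q ff 3 3 1 2 6)
  (.S ff 4 4
  (.S tt 5 4
  (.S ff 5 3
  (.N ff 3 4 1 7)
  (.Q ff 3 4 1 4 4))
  (.S ff 5 3
  (.Q ff 5 4 0 3 5)
  (.Q ff 5 1 2 6 6)))
  (.S tt 5 4
  (.S ff 5 3
  (.Q ff 3 4 1 6 2)
  (.Q ff 5 4 0 5 7))
  (.S ff 5 3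
  (.P ff 4 3 2 3 3)
  (.P ff 4 3 2 4 2)))))
  (.S ff 5 2
  (.P ff 5 2 0 3 3)
  (.Q ff 5 3 0 6 2)))
  (.S tt 5 2
  (.S ff 5 2
  (.S ff 4 4
  (.S tt 4 5
  (.S ff 3 5
  (.P ff 4 4 0 1 5)
  (.Q ff 4 3 2 4 4))
  (.S ff 3 5
  (.Q ff 4 5 0 5 3)
  (.S tt 5 4
  (.S ff 5 3
  (.Q ff 3 4 1 3 5)
  (.P ff 5 3 2 5 5))
  (.S ff 5 3
  (.S tt 6 2
  (.S tt 6 3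
  (.S ff 6 2
  (.N ff 4 3 1 7)
  (.Q ff 4 3 1 4 4))
  (.S ff 6 2
  (.Q ff 6 3 0 3 5)
  (.P ff 3 5 0 7 7)))
  (.S ff 5 1
  (.S tt 6 1
  (.S ff 6 1
  (.N ff 6 2 0 7)
  (.Q ff 6 2 0 6 2))
  (.S ff 6 1
  (.Q ff 6 2 0 5 3)
  (.P ff 5 2 1 3 3)))
  (.S tt 6 1
  (.S ff 6 1
  (.Q ff 6 2 0 4 4)
  (.Q ff 6 0 2 6 6))
  (.S ff 6 1
  (.Q tt 7 1 1 7 5)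
  (.P ff 5 2 1 4 2)))))
  (.Q tt 4 3 0 3 5)))))
  (.S tt 5 4
  (.S ff 5 3
  (.P ff 4 2 1 5 5)
  (.Q ff 5 4 0 4 4))
  (.S ff 5 3
  (.Q tt 4 3 0 5 3)
  (.P ff 4 3 2 5 1))))
  (.Q ff 5 1 2 4 4))
  (.S ff 5 2
  (.Q tt 6 2 1 5 3)
  (.P ff 4 3 1 5 1))))
  (.S ff 2 4
  (.S ff 2 5
  (.S tt 2 5
  (.N ff 3 5 0 7)
  (.Q ff 3 5 0 3 5))
  (.S tt 2 5
  (.Q ff 3 5 0 2 6)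
  (.P ff 2 4 2 3 3)))
  (.S tt 2 5
  (.S ff 2 5
  (.Q ff 3 5 0 4 4)
  (.Q ff 1 5 1 6 6))
  (.S ff 2 5
  (.Q tt 5 3 1 7 5)
  (.P ff 2 4 1 2 4))))))
  (.Q ff 2 4 1 4 4)))
  (.S tt 4 4
  (.S ff 3 4
  (.P ff 4 3 2 3 3)
  (.Q ff 4 4 0 5 3))
  (.S ff 3 4
  (.P ff 3 4 1 4 2)
  (.P ff 3 4 0 1 5)))

lemma chk_cert : chk [((false, 3, 3), true), ((true, 4, 3), true), ((true, 3, 4), false)] cert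
    = true := by
  decide +kernel

lemma base_true (hk : 3 ≤ k) {ε : Vt k → Bool} (hε : Good ε)
    (h0 : ε (cv k (false, 3, 3)) = true) (h1 : ε (cv k (true, 4, 3)) = true) :
    ε (cv k (true, 3, 4)) = true := by
  by_contra h2
  refine chk_sound hk hε cert _ ?_ chk_cert
  intro p hp
  simp only [List.mem_cons, List.not_mem_nil, or_false] at hp
  rcases hp with rfl | rfl | rfl
  · exact h0
  · exact h1
  · simpa using h2

lemma base (hk : 3 ≤ k) {ε : Vt k → Bool} (hε : Good ε)
    (h : ε (nb (cv k (false, 3, 3)) 1) = ε (cv k (false, 3, 3))) :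
    ε (nb (cv k (false, 3, 3)) 2) = ε (cv k (false, 3, 3)) := by
  have e1 : nb (cv k (false, 3, 3)) 1 = cv k (true, 4, 3) := by
    rw [← cv_znb]; congr 1
  have e2 : nb (cv k (false, 3, 3)) 2 = cv k (true, 3, 4) := by
    rw [← cv_znb]; congr 1
  rw [e1] at h
  rw [e2]
  cases hb : ε (cv k (false, 3, 3)) with
  | true => exact base_true hk hε hb (by rw [h, hb])
  | false =>
    have := base_true hk hε.neg (by simp [hb]) (by simp [h, hb])
    simpa using this

/-- Translations. -/
def trans (a b : ZMod k) : Vt k ≃ Vt k where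
  toFun v := (v.1, v.2.1 + a, v.2.2 + b)
  invFun v := (v.1, v.2.1 - a, v.2.2 - b)
  left_inv v := by simp
  right_inv v := by simp

lemma trans_nb (a b : ZMod k) (v : Vt k) (c : Fin 3) :
    nb (trans a b v) (c + 0) = trans a b (nb v c) := by
  obtain ⟨t, i, j⟩ := v
  cases t <;> simp [trans, nb] <;> constructor <;> ring

/-- Rotation by 120 degrees about the black vertex at the origin. -/
def turn : Vt k ≃ Vt k where
  toFun v := (v.1, (if v.1 then 1 else 0) - v.2.1 - v.2.2, v.2.1)
  invFun v := (v.1, v.2.2, (if v.1 then 1 else 0) - v.2.1 - v.2.2)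
  left_inv v := by
    obtain ⟨t, i, j⟩ := v
    simp only [Prod.mk.injEq, true_and]
    ring
  right_inv v := by
    obtain ⟨t, i, j⟩ := v
    simp only [Prod.mk.injEq, true_and, and_true]
    ring

lemma turn_nb (v : Vt k) (c : Fin 3) : nb (turn v) (c + 1) = turn (nb v c) := by
  obtain ⟨t, i, j⟩ := v
  cases t <;> fin_cases c <;> simp [turn, nb, oi, oj] <;> ring

/-- The half turn exchanging black and white. -/
def half : Vt k ≃ Vt k where
  toFun v := (!v.1, -v.2.1, -v.2.2)
  invFun v := (!v.1, -v.2.1, -v.2.2)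
  left_inv v := by simp
  right_inv v := by simp

lemma half_nb (v : Vt k) (c : Fin 3) : nb (half v) (c + 0) = half (nb v c) := by
  obtain ⟨t, i, j⟩ := v
  cases t <;> simp [half, nb] <;> constructor <;> ring

/-- Equality of signs along an edge propagates to the next edge, around a vertex. -/
def Prp (v : Vt k) (c : Fin 3) : Prop :=
  ∀ ε : Vt k → Bool, Good ε → ε (nb v c) = ε v → ε (nb v (c + 1)) = ε v

lemma Prp.move {v : Vt k} {c : Fin 3} (h : Prp v c) (g : Vt k ≃ Vt k) (s : Fin 3)
    (hg : ∀ v c, nb (g v) (c + s) = g (nb v c)) : Prp (g v) (c + s) := by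
  intro ε hε h1
  have := h _ (hε.comp g s hg) (by simpa [Function.comp, ← hg] using h1)
  rw [add_right_comm]
  simpa [Function.comp, ← hg] using this

lemma prp_all (hk : 3 ≤ k) (v : Vt k) (c : Fin 3) : Prp v c := by
  have h1 : Prp (cv k (false, 3, 3)) 1 := fun ε hε h => base hk hε h
  have h2 : Prp ((false, 0, 0) : Vt k) 1 := by
    have := h1.move (trans (-3) (-3)) 0 (trans_nb _ _)
    simpa [trans, cv] using this
  have h3 : Prp ((false, 0, 0) : Vt k) 2 := by
    have := h2.move turn 1 turn_nb
    simpa [turn] using this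
  have h4 : Prp ((false, 0, 0) : Vt k) 0 := by
    have := h3.move turn 1 turn_nb
    simpa [turn] using this
  have h5 : ∀ c, Prp ((false, 0, 0) : Vt k) c := by
    intro c; fin_cases c <;> assumption
  have h6 : ∀ c, Prp ((true, 0, 0) : Vt k) c := by
    intro c
    have := (h5 c).move half 0 half_nb
    simpa [half] using this
  obtain ⟨t, i, j⟩ := v
  cases t
  · have := (h5 c).move (trans i j) 0 (trans_nb _ _)
    simpa [trans] using this
  · have := (h6 c).move (trans i j) 0 (trans_nb _ _)
    simpa [trans] using this

lemma same_colour (hk : 3 ≤ k) {ε : Vt k → Bool} (hε : Good ε) (v : Vt k) (c c' : Fin 3)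
    (h : ε (nb v c) = ε v) : ε (nb v c') = ε v := by
  have h1 := prp_all hk v c ε hε h
  have h2 := prp_all hk v (c + 1) ε hε h1
  have : c' = c ∨ c' = c + 1 ∨ c' = c + 1 + 1 := by
    clear h h1 h2
    revert c c'; decide
  rcases this with rfl | rfl | rfl <;> assumption

/-- Connectivity of the grid. -/
lemma conn (hk : 3 ≤ k) (p : Vt k → Prop) (h : ∀ v c, p v → p (nb v c)) (v w : Vt k)
    (hv : p v) : p w := by
  have : NeZero k := ⟨by omega⟩
  -- moves
  have hi : ∀ i j, p (false, i, j) → p (false, i + 1, j) := by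
    intro i j hp
    have := h _ 0 (h _ 1 hp)
    simpa [nb, oi, oj] using this
  have hj : ∀ i j, p (false, i, j) → p (false, i, j + 1) := by
    intro i j hp
    have := h _ 0 (h _ 2 hp)
    simpa [nb, oi, oj] using this
  have hin : ∀ (n : ℕ) i j, p (false, i, j) → p (false, i + n, j) := by
    intro n
    induction n with
    | zero => simp
    | succ n ih =>
      intro i j hp
      have := hi _ _ (ih i j hp)
      simpa [add_assoc] using this
  have hjn : ∀ (n : ℕ) i j, p (false, i, j) → p (false, i, j + n) := by
    intro n
    induction n with
    | zero => simp
    | succ n ih =>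
      intro i j hp
      have := hj _ _ (ih i j hp)
      simpa [add_assoc] using this
  have hbb : ∀ i j i' j', p (false, i, j) → p (false, i', j') := by
    intro i j i' j' hp
    have h1 := hin (i' - i).val i j hp
    have h2 := hjn (j' - j).val _ _ h1
    simpa using h2
  obtain ⟨t, i, j⟩ := v
  obtain ⟨t', i', j'⟩ := w
  have hb : ∃ a b, p (false, a, b) := by
    cases t
    · exact ⟨_, _, hv⟩
    · have := h _ 0 hv
      simp only [nb, if_true] at this
      exact ⟨_, _, this⟩
  obtain ⟨a, b, hab⟩ := hb
  cases t'
  · exact hbb _ _ _ _ hab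
  · have := h _ 0 (hbb _ _ i' j' hab)
    simpa [nb, oi, oj] using this

theorem good_classify (hk : 3 ≤ k) {ε : Vt k → Bool} (hε : Good ε) :
    (∃ b : Bool, ∀ v, ε v = b) ∨ (∃ b : Bool, ∀ v, ε v = (v.1 != b)) := by
  have hS : ∀ v c, (∀ c', ε (nb v c') = ε v) → ∀ c', ε (nb (nb v c) c') = ε (nb v c) := by
    intro v c h c'
    apply same_colour hk hε _ c
    rw [nb_nb, h]
  by_cases h0 : ε (nb (false, 0, 0) 0) = ε ((false, 0, 0) : Vt k)
  · left
    have h1 : ∀ v c, ε (nb v c) = ε v := by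
      intro v
      exact conn hk (fun v => ∀ c, ε (nb v c) = ε v) (fun v c => hS v c) (false, 0, 0) v
        (fun c => same_colour hk hε _ 0 c h0)
    exact ⟨ε (false, 0, 0), fun v => conn hk (fun v => ε v = ε (false, 0, 0))
      (fun v c h => by rw [h1]; exact h) (false, 0, 0) v rfl⟩
  · right
    have h1 : ∀ v c, ε (nb v c) ≠ ε v := by
      intro v c h
      apply h0
      exact conn hk (fun v => ∀ c, ε (nb v c) = ε v) (fun v c => hS v c) v (false, 0, 0)
        (fun c' => same_colour hk hε _ c c' h) 0
    refine ⟨ε (false, 0, 0), fun v => conn hk (fun v => ε v = (v.1 != ε (false, 0, 0)))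
      (fun v c h => ?_) (false, 0, 0) v (by simp)⟩
    have h2 := h1 v c
    have h3 : (nb v c).1 = !v.1 := by
      obtain ⟨t, i, j⟩ := v
      cases t <;> simp [nb]
    rw [h3]
    rw [h] at h2
    generalize ε (false, 0, 0) = x at *
    generalize ε (nb v c) = y at *
    generalize v.1 = z at *
    revert h2; clear h h3 h0
    revert x y z; decide

/-! ### The two good sign patterns -/

lemma sameCycle_iff_lab {α L : Type*} (f : Equiv.Perm α) (lab : α → L)
    (h1 : ∀ d, lab (f d) = lab d) (h2 : ∀ x y, lab x = lab y → f.SameCycle x y) (x y : α) :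
    f.SameCycle x y ↔ lab x = lab y := by
  refine ⟨?_, h2 x y⟩
  have hn : ∀ (n : ℕ) x, lab ((f ^ n) x) = lab x := by
    intro n
    induction n with
    | zero => simp
    | succ n ih => intro x; rw [pow_succ', Equiv.Perm.mul_apply, h1, ih]
  rintro ⟨n, rfl⟩
  obtain ⟨m, rfl | rfl⟩ := n.eq_nat_or_neg
  · simp [hn]
  · have := hn m ((f ^ (-(m : ℤ))) x)
    rw [← this]
    simp

lemma sc_step {α : Type*} (f : Equiv.Perm α) {x y : α} (h : f.SameCycle (f x) y) :
    f.SameCycle x y := Equiv.Perm.sameCycle_apply_left.1 h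

lemma neg_one_fin : (-1 : Fin 3) = 2 := rfl

def ε1 : Vt k → Bool := fun _ => true
def ε2 : Vt k → Bool := fun v => !v.1

/-- Labels of the hexagonal faces. -/
def lab1 (d : Dt k) : ZMod k × ZMod k :=
  if d.1.1 then
    (if d.2 = 0 then (d.1.2.1 + 1, d.1.2.2 - 1) else
      if d.2 = 1 then (d.1.2.1, d.1.2.2) else (d.1.2.1, d.1.2.2 - 1))
  else
    (if d.2 = 0 then (d.1.2.1, d.1.2.2) else
      if d.2 = 1 then (d.1.2.1 + 1, d.1.2.2 - 1) else (d.1.2.1 + 1, d.1.2.2))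

/-- Labels of the zigzag faces. -/
def lab2 (d : Dt k) : Fin 3 × ZMod k :=
  if d.1.1 then
    (if d.2 = 0 then (1, d.1.2.2) else
      if d.2 = 1 then (2, d.1.2.1 + d.1.2.2 - 1) else (0, d.1.2.1))
  else
    (if d.2 = 0 then (0, d.1.2.1) else
      if d.2 = 1 then (1, d.1.2.2) else (2, d.1.2.1 + d.1.2.2))

lemma lab1_Fm (d : Dt k) : lab1 (Fm ε1 d) = lab1 d := by
  obtain ⟨⟨t, i, j⟩, c⟩ := d
  cases t <;> fin_cases c <;> simp [lab1, Fm_apply, nb, oi, oj, ε1]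

lemma lab2_Fm (d : Dt k) : lab2 (Fm ε2 d) = lab2 d := by
  obtain ⟨⟨t, i, j⟩, c⟩ := d
  cases t <;> fin_cases c <;> simp [lab2, Fm_apply, nb, oi, oj, ε2, neg_one_fin] <;> ring

lemma lab1_canon (d : Dt k) : (Fm ε1).SameCycle d ((false, lab1 d), 0) := by
  obtain ⟨⟨t, i, j⟩, c⟩ := d
  have hb0 : ∀ i j : ZMod k, (Fm ε1).SameCycle ((false, i, j), 0) ((false, i, j), 0) :=
    fun _ _ => Equiv.Perm.SameCycle.refl _ _
  have hw2 : ∀ i j : ZMod k, (Fm ε1).SameCycle ((true, i, j), 2) ((false, i, j - 1), 0) := by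
    intro i j
    apply sc_step
    simpa [Fm_apply, nb, oi, oj, ε1] using hb0 i (j - 1)
  have hb1 : ∀ i j : ZMod k, (Fm ε1).SameCycle ((false, i, j), 1) ((false, i + 1, j - 1), 0) := by
    intro i j
    apply sc_step
    simpa [Fm_apply, nb, oi, oj, ε1] using hw2 (i + 1) j
  have hw0 : ∀ i j : ZMod k, (Fm ε1).SameCycle ((true, i, j), 0) ((false, i + 1, j - 1), 0) := by
    intro i j
    apply sc_step
    simpa [Fm_apply, nb, oi, oj, ε1] using hb1 i j
  have hb2 : ∀ i j : ZMod k, (Fm ε1).SameCycle ((false, i, j), 2) ((false, i + 1, j), 0) := by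
    intro i j
    apply sc_step
    simpa [Fm_apply, nb, oi, oj, ε1] using hw0 i (j + 1)
  have hw1 : ∀ i j : ZMod k, (Fm ε1).SameCycle ((true, i, j), 1) ((false, i, j), 0) := by
    intro i j
    apply sc_step
    simpa [Fm_apply, nb, oi, oj, ε1] using hb2 (i - 1) j
  cases t <;> fin_cases c <;> simp only [lab1]
  · exact hb0 i j
  · exact hb1 i j
  · exact hb2 i j
  · exact hw0 i j
  · exact hw1 i j
  · exact hw2 i j

lemma same1 (x y : Dt k) : (Fm ε1).SameCycle x y ↔ lab1 x = lab1 y := by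
  apply sameCycle_iff_lab _ _ lab1_Fm
  intro x y h
  have h1 := lab1_canon x
  have h2 := lab1_canon y
  rw [h] at h1
  exact h1.trans h2.symm

/-- A canonical dart of each zigzag face. -/
def can2 (l : Fin 3 × ZMod k) : Dt k :=
  if l.1 = 0 then ((false, l.2, 0), 0) else
    if l.1 = 1 then ((false, 0, l.2), 1) else ((false, 0, l.2), 2)

lemma lab2_canon (hk : 3 ≤ k) (d : Dt k) : (Fm ε2).SameCycle d (can2 (lab2 d)) := by
  have : NeZero k := ⟨by omega⟩
  obtain ⟨⟨t, i, j⟩, c⟩ := d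
  have hb0 : ∀ i j : ZMod k, (Fm ε2).SameCycle ((false, i, j), 0) ((false, i, 0), 0) := by
    have : ∀ (n : ℕ) (i j : ZMod k), j = n →
        (Fm ε2).SameCycle ((false, i, j), 0) ((false, i, 0), 0) := by
      intro n
      induction n with
      | zero =>
        intro i j h
        simp only [Nat.cast_zero] at h
        simp only [h, zero_add]
        exact Equiv.Perm.SameCycle.refl _ _
      | succ n ih =>
        intro i j h
        apply sc_step; apply sc_step
        simpa [Fm_apply, nb, oi, oj, ε2, neg_one_fin] using ih i (j - 1) (by rw [h]; push_cast; ring)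
    intro i j
    exact this j.val i j (by simp)
  have hb1 : ∀ i j : ZMod k, (Fm ε2).SameCycle ((false, i, j), 1) ((false, 0, j), 1) := by
    have : ∀ (n : ℕ) (i j : ZMod k), -i = n →
        (Fm ε2).SameCycle ((false, i, j), 1) ((false, 0, j), 1) := by
      intro n
      induction n with
      | zero =>
        intro i j h
        simp only [Nat.cast_zero, neg_eq_zero] at h
        simp only [h]
        exact Equiv.Perm.SameCycle.refl _ _
      | succ n ih =>
        intro i j h
        apply sc_step; apply sc_step
        simpa [Fm_apply, nb, oi, oj, ε2, neg_one_fin] using ih (i + 1) j (by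
          rw [neg_add, h]; push_cast; ring)
    intro i j
    exact this (-i).val i j (by simp)
  have hb2 : ∀ i j : ZMod k, (Fm ε2).SameCycle ((false, i, j), 2) ((false, 0, i + j), 2) := by
    have : ∀ (n : ℕ) (i j : ZMod k), i = n →
        (Fm ε2).SameCycle ((false, i, j), 2) ((false, 0, i + j), 2) := by
      intro n
      induction n with
      | zero =>
        intro i j h
        simp only [Nat.cast_zero] at h
        simp only [h, zero_add]
        exact Equiv.Perm.SameCycle.refl _ _
      | succ n ih =>
        intro i j h
        apply sc_step; apply sc_step
        have h2 := ih (i - 1) (j + 1) (by rw [h]; push_cast; ring)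
        have e : i - 1 + (j + 1) = i + j := by ring
        rw [e] at h2
        simpa [Fm_apply, nb, oi, oj, ε2, neg_one_fin] using h2
    intro i j
    exact this i.val i j (by simp)
  cases t <;> fin_cases c <;> simp only [lab2, can2]
  · exact hb0 i j
  · exact hb1 i j
  · exact hb2 i j
  · apply sc_step
    simpa [Fm_apply, nb, oi, oj, ε2, neg_one_fin] using hb1 i j
  · apply sc_step
    have := hb2 (i - 1) j
    rw [sub_add_eq_add_sub] at this
    simpa [Fm_apply, nb, oi, oj, ε2, neg_one_fin] using this
  · apply sc_step
    simpa [Fm_apply, nb, oi, oj, ε2, neg_one_fin] using hb0 i (j - 1)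

lemma same2 (hk : 3 ≤ k) (x y : Dt k) : (Fm ε2).SameCycle x y ↔ lab2 x = lab2 y := by
  apply sameCycle_iff_lab _ _ lab2_Fm
  intro x y h
  have h1 := lab2_canon hk x
  have h2 := lab2_canon hk y
  rw [h] at h1
  exact h1.trans h2.symm

lemma one_ne (hk : 3 ≤ k) : (1 : ZMod k) ≠ 0 := by
  have := small_sound (k := k) hk (z := 1) (by decide)
  simpa using this

lemma two_ne (hk : 3 ≤ k) : (1 : ZMod k) + 1 ≠ 0 := by
  have := small_sound (k := k) hk (z := 2) (by decide)
  intro h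
  apply this
  push_cast
  rw [← h]; norm_num

/-- The dual edge crossed by a dart, in the hexagonal embedding. -/
def dir1 (t : Bool) (c : Fin 3) : ℤ × ℤ :=
  if t then (if c = 0 then (-1, 1) else if c = 1 then (0, -1) else (1, 0))
  else (if c = 0 then (1, -1) else if c = 1 then (0, 1) else (-1, 0))

lemma lab1_inv (d : Dt k) : lab1 (inv d) =
    ((lab1 d).1 + ((dir1 d.1.1 d.2).1 : ℤ), (lab1 d).2 + ((dir1 d.1.1 d.2).2 : ℤ)) := by
  obtain ⟨⟨t, i, j⟩, c⟩ := d
  cases t <;> fin_cases c <;> simp [lab1, inv_apply, nb, oi, oj, dir1]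
  all_goals ring

lemma good1 (hk : 3 ≤ k) : Good (ε1 : Vt k → Bool) := by
  refine ⟨fun d h => ?_, fun x y h1 h2 => ?_⟩
  · rw [same1, lab1_inv, Prod.ext_iff] at h
    obtain ⟨⟨t, i, j⟩, c⟩ := d
    have h0 := one_ne hk
    cases t <;> fin_cases c <;> simp [dir1, h0] at h
  · rw [same1] at h1 h2
    rw [lab1_inv, lab1_inv, h1, Prod.ext_iff] at h2
    simp only [add_right_inj] at h2
    have hs : ∀ a b : ℤ, ((a : ℤ) : ZMod k) = (b : ℤ) → small (a - b) = false := by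
      intro a b hab
      by_contra hsm
      exact small_sound hk (by simpa using hsm) (by push_cast; rw [hab, sub_self])
    have h3 := hs _ _ h2.1
    have h4 := hs _ _ h2.2
    have key : ∀ t t' c c', small ((dir1 t c).1 - (dir1 t' c').1) = false →
        small ((dir1 t c).2 - (dir1 t' c').2) = false → t = t' ∧ c = c' := by decide
    obtain ⟨e1, e2⟩ := key _ _ _ _ h3 h4
    obtain ⟨⟨t, i, j⟩, c⟩ := x
    obtain ⟨⟨t', i', j'⟩, c'⟩ := y
    simp only at e1 e2
    subst e1 e2
    cases t <;> fin_cases c <;> simpa [lab1] using h1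

lemma good2 (hk : 3 ≤ k) : Good (ε2 : Vt k → Bool) := by
  refine ⟨fun d h => ?_, fun x y h1 h2 => ?_⟩
  · rw [same2 hk] at h
    obtain ⟨⟨t, i, j⟩, c⟩ := d
    cases t <;> fin_cases c <;> simp [lab2, inv_apply, nb, oi, oj] at h
  · rw [same2 hk] at h1 h2
    obtain ⟨⟨t, i, j⟩, c⟩ := x
    obtain ⟨⟨t', i', j'⟩, c'⟩ := y
    cases t <;> cases t' <;> fin_cases c <;> fin_cases c' <;>
      simp [lab2, inv_apply, nb, oi, oj] at h1 h2 ⊢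
    all_goals first | exact ⟨h1, h2⟩ | exact ⟨h2, h1⟩ | skip
    all_goals grind

lemma lab1_surj : Function.Surjective (lab1 : Dt k → _) := fun l =>
  ⟨((false, l), 0), by simp [lab1]⟩

lemma lab2_surj : Function.Surjective (lab2 : Dt k → _) := by
  rintro ⟨a, x⟩
  refine ⟨can2 (a, x), ?_⟩
  fin_cases a <;> simp [can2, lab2]

lemma sc_eq {α : Type*} (f : Equiv.Perm α) {x y : α} (h : f x = y) : f.SameCycle x y :=
  sc_step f (h ▸ Equiv.Perm.SameCycle.refl _ _)

lemma nb_fst (v : Vt k) (c : Fin 3) : (nb v c).1 = !v.1 := by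
  obtain ⟨t, i, j⟩ := v
  cases t <;> simp [nb]

lemma nb_inj (hk : 3 ≤ k) (v : Vt k) {c c' : Fin 3} (h : nb v c = nb v c') : c = c' := by
  have h0 := one_ne hk
  obtain ⟨t, i, j⟩ := v
  cases t <;> fin_cases c <;> fin_cases c' <;> simp [nb, oi, oj, h0] at h ⊢
  all_goals exact h0 (by linear_combination h)

section Transfer

set_option linter.unusedSectionVars false

variable {V : Type} [Fintype V] [DecidableEq V]

/-- The hexagonal grid graph carried over to `V` through a bijection. -/
def gr (e : V ≃ Vt k) : SimpleGraph V where
  Adj u w := ∃ c, nb (e u) c = e w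
  symm := ⟨fun u w ⟨c, h⟩ => ⟨c, by rw [← h, nb_nb]⟩⟩
  loopless := ⟨fun u ⟨c, h⟩ => by
    have := nb_fst (e u) c
    rw [h] at this
    cases h' : (e u).1 <;> simp [h'] at this⟩

/-- The dart of the graph given by a tail and a colour. -/
def toD (e : V ≃ Vt k) (x : Dt k) : (gr e).Dart :=
  ⟨(e.symm x.1, e.symm (nb x.1 x.2)), ⟨x.2, by simp⟩⟩

lemma toD_fst (e : V ≃ Vt k) (x : Dt k) : (toD e x).fst = e.symm x.1 := rfl
lemma toD_snd (e : V ≃ Vt k) (x : Dt k) : (toD e x).snd = e.symm (inv x).1 := rfl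

lemma toD_symm (e : V ≃ Vt k) (x : Dt k) : (toD e x).symm = toD e (inv x) := by
  ext1
  simp [toD, inv_apply, nb_nb]

lemma toD_bij (hk : 3 ≤ k) (e : V ≃ Vt k) : Function.Bijective (toD e) := by
  constructor
  · intro x y h
    have h1 : e.symm x.1 = e.symm y.1 := congrArg (fun d => d.fst) h
    have h2 : e.symm (nb x.1 x.2) = e.symm (nb y.1 y.2) := congrArg (fun d => d.snd) h
    have h1 := e.symm.injective h1
    have h2 := e.symm.injective h2
    rw [h1] at h2
    exact Prod.ext h1 (nb_inj hk _ h2)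
  · rintro ⟨⟨u, w⟩, c, h⟩
    refine ⟨(e u, c), ?_⟩
    ext1
    simp only at h
    simp [toD, h]

/-- Darts of the graph are pairs (tail, colour). -/
noncomputable def psi (hk : 3 ≤ k) (e : V ≃ Vt k) : Dt k ≃ (gr e).Dart :=
  Equiv.ofBijective _ (toD_bij hk e)

lemma psi_apply (hk : 3 ≤ k) (e : V ≃ Vt k) (x : Dt k) : psi hk e x = toD e x := rfl

lemma rotc_cases (ε : Vt k → Bool) (x y : Dt k) (h : x.1 = y.1) :
    x = y ∨ rotc ε x = y ∨ rotc ε y = x := by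
  obtain ⟨v, c⟩ := x
  obtain ⟨v', c'⟩ := y
  simp only at h
  subst h
  have key : ∀ (b : Bool) (c c' : Fin 3), c = c' ∨ (if b then c + 1 else c - 1) = c' ∨
      (if b then c' + 1 else c' - 1) = c := by decide
  simpa [rotc] using key (ε v) c c'

lemma rotc_ne (ε : Vt k → Bool) (x : Dt k) : rotc ε x ≠ x := by
  obtain ⟨v, c⟩ := x
  have key : ∀ (b : Bool) (c : Fin 3), (if b then c + 1 else c - 1) ≠ c := by decide
  intro h
  exact key (ε v) c (congrArg Prod.snd h)

lemma rotc_fst (ε : Vt k → Bool) (x : Dt k) : (rotc ε x).1 = x.1 := rfl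

lemma psi_conj (hk : 3 ≤ k) (e : V ≃ Vt k) (f : Equiv.Perm (Dt k)) (x : Dt k) :
    (psi hk e).permCongr f (psi hk e x) = psi hk e (f x) := by
  simp [Equiv.permCongr_apply]

/-- The rotation system with signs `ε`. -/
noncomputable def rot (hk : 3 ≤ k) (e : V ≃ Vt k) (ε : Vt k → Bool) : RotationSystem (gr e) where
  σ := (psi hk e).permCongr (rotc ε)
  tail_fixed d := by
    obtain ⟨x, rfl⟩ := (psi hk e).surjective d
    rw [psi_conj, psi_apply, psi_apply, toD_fst, toD_fst, rotc_fst]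
  orbit_tail d d' h := by
    obtain ⟨x, rfl⟩ := (psi hk e).surjective d
    obtain ⟨y, rfl⟩ := (psi hk e).surjective d'
    rw [psi_apply, psi_apply, toD_fst, toD_fst] at h
    rw [← sameCycle_transfer (rotc ε) _ (psi hk e) (fun x => (psi_conj hk e _ x).symm)]
    rcases rotc_cases ε x y (e.symm.injective h) with h | h | h
    · rw [h]
    · rw [← h]
      exact sc_eq _ rfl
    · rw [← h]
      exact (sc_eq _ rfl).symm

lemma sameFace_iff (hk : 3 ≤ k) (e : V ≃ Vt k) (ε : Vt k → Bool) (x y : Dt k) :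
    (rot hk e ε).SameFace (toD e x) (toD e y) ↔ (Fm ε).SameCycle x y := by
  rw [← psi_apply hk, ← psi_apply hk]
  refine (sameCycle_transfer (Fm ε) _ (psi hk e) (fun x => ?_) x y).symm
  change _ = (psi hk e).permCongr (rotc ε) ((psi hk e x).symm)
  rw [psi_apply, psi_apply, toD_symm, ← psi_apply hk, ← psi_apply hk, psi_conj]
  rfl

lemma toD_edge_iff (hk : 3 ≤ k) (e : V ≃ Vt k) (x y : Dt k) :
    (toD e x).edge = (toD e y).edge ↔ x = y ∨ x = inv y := by
  rw [SimpleGraph.dart_edge_eq_iff, toD_symm, (toD_bij hk e).1.eq_iff, (toD_bij hk e).1.eq_iff]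

lemma Fm_inv (ε : Vt k → Bool) (x : Dt k) : Fm ε (inv x) = rotc ε x := by
  change rotc ε (inv (inv x)) = _
  rw [inv_inv]

lemma good_of_poly (hk : 3 ≤ k) (e : V ≃ Vt k) (ε : Vt k → Bool)
    (h : (rot hk e ε).Polyhedral) : Good ε := by
  obtain ⟨hs, hp⟩ := h
  have h1 : ∀ d, ¬ (Fm ε).SameCycle d (inv d) := by
    intro d hd
    have h2 : (Fm ε).SameCycle (inv d) (rotc ε (inv d)) := by
      refine hd.symm.trans ?_
      have := Fm_inv ε (inv d)
      rw [inv_inv] at this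
      exact sc_eq _ this
    have h3 := hs _ _ ((sameFace_iff hk e ε _ _).2 h2) (by rw [toD_fst, toD_fst, rotc_fst])
    exact rotc_ne ε _ ((toD_bij hk e).1 h3).symm
  refine ⟨h1, fun x y hx hy => ?_⟩
  have hn : ¬ (rot hk e ε).SameFace (toD e x) (toD e (inv x)) := by
    rw [sameFace_iff]
    exact h1 x
  have hm : ∀ z, (Fm ε).SameCycle x z → (Fm ε).SameCycle (inv x) (inv z) →
      (toD e z).edge ∈ (rot hk e ε).faceEdges (toD e x) ∩
        (rot hk e ε).faceEdges (toD e (inv x)) := by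
    intro z hz1 hz2
    refine ⟨⟨_, (sameFace_iff hk e ε _ _).2 hz1, rfl⟩, ⟨_, (sameFace_iff hk e ε _ _).2 hz2, ?_⟩⟩
    rw [← toD_symm, SimpleGraph.Dart.edge_symm]
  have mx := hm x (Equiv.Perm.SameCycle.refl _ _) (Equiv.Perm.SameCycle.refl _ _)
  have my := hm y hx hy
  rcases hp _ _ hn with h | ⟨v, -, h⟩ | ⟨u, w, -, -, h⟩
  · have : (toD e x).fst ∈ (rot hk e ε).faceVerts (toD e x) ∩
        (rot hk e ε).faceVerts (toD e (inv x)) := by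
      refine ⟨⟨_, Equiv.Perm.SameCycle.refl _ _, rfl⟩,
        ⟨toD e (rotc ε x), (sameFace_iff hk e ε _ _).2 (sc_eq _ (Fm_inv ε x)), ?_⟩⟩
      rw [toD_fst, toD_fst, rotc_fst]
    rw [h] at this
    exact this.elim
  · rw [h] at mx
    exact mx.elim
  · rw [h, Set.mem_singleton_iff] at mx my
    rcases (toD_edge_iff hk e x y).1 (mx.trans my.symm) with h | h
    · exact h
    · exfalso
      apply h1 x
      rw [h, inv_inv, ← h]
      exact hx

lemma shared (ε : Vt k → Bool) {a b p q : Dt k} (hab : ¬ (Fm ε).SameCycle a b)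
    (hp : (Fm ε).SameCycle a p) (hq : (Fm ε).SameCycle b q) (h : p.1 = q.1) :
    ∃ x, (Fm ε).SameCycle a x ∧ (Fm ε).SameCycle b (inv x) ∧
      (p.1 = x.1 ∨ p.1 = (inv x).1) := by
  rcases rotc_cases ε p q h with h' | h' | h'
  · subst h'
    exact absurd (hp.trans hq.symm) hab
  · refine ⟨p, hp, hq.trans (sc_eq _ ?_).symm, Or.inl rfl⟩
    rw [Fm_inv, h']
  · refine ⟨inv q, hp.trans (sc_eq _ ?_).symm, by rwa [inv_inv], Or.inr ?_⟩
    · rw [Fm_inv, h']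
    · rw [inv_inv, h]

lemma poly_of_good (hk : 3 ≤ k) (e : V ≃ Vt k) (ε : Vt k → Bool) (hg : Good ε) :
    (rot hk e ε).Polyhedral := by
  obtain ⟨h1, h2⟩ := hg
  refine ⟨fun d d' hd ht => ?_, fun d d' hd => ?_⟩
  · obtain ⟨x, rfl⟩ := (toD_bij hk e).2 d
    obtain ⟨y, rfl⟩ := (toD_bij hk e).2 d'
    rw [sameFace_iff] at hd
    rw [toD_fst, toD_fst] at ht
    rcases rotc_cases ε x y (e.symm.injective ht) with h | h | h
    · rw [h]
    · exact absurd (hd.trans (sc_eq _ ((Fm_inv ε x).trans h)).symm) (h1 x)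
    · exact absurd (hd.symm.trans (sc_eq _ ((Fm_inv ε y).trans h)).symm) (h1 y)
  · obtain ⟨a, rfl⟩ := (toD_bij hk e).2 d
    obtain ⟨b, rfl⟩ := (toD_bij hk e).2 d'
    rw [sameFace_iff] at hd
    by_cases hem : (rot hk e ε).faceVerts (toD e a) ∩ (rot hk e ε).faceVerts (toD e b) = ∅
    · exact Or.inl hem
    have get : ∀ v ∈ (rot hk e ε).faceVerts (toD e a) ∩ (rot hk e ε).faceVerts (toD e b),
        ∃ x, (Fm ε).SameCycle a x ∧ (Fm ε).SameCycle b (inv x) ∧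
          (v = (toD e x).fst ∨ v = (toD e x).snd) := by
      rintro v ⟨⟨d, hda, rfl⟩, ⟨d', hdb, hv⟩⟩
      obtain ⟨p, rfl⟩ := (toD_bij hk e).2 d
      obtain ⟨q, rfl⟩ := (toD_bij hk e).2 d'
      rw [sameFace_iff] at hda hdb
      rw [toD_fst, toD_fst] at hv
      obtain ⟨x, hx1, hx2, hx3⟩ := shared ε hd hda hdb (e.symm.injective hv).symm
      refine ⟨x, hx1, hx2, ?_⟩
      rw [toD_fst, toD_fst, toD_snd]
      rcases hx3 with h | h
      · left; rw [h]
      · right; rw [h]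
    obtain ⟨v, hv⟩ := Set.nonempty_iff_ne_empty.2 hem
    obtain ⟨x, hxa, hxb, -⟩ := get v hv
    have uniq : ∀ y, (Fm ε).SameCycle a y → (Fm ε).SameCycle b (inv y) → y = x :=
      fun y hya hyb => h2 y x (hya.symm.trans hxa) (hyb.symm.trans hxb)
    refine Or.inr (Or.inr ⟨(toD e x).fst, (toD e x).snd, (toD e x).adj, ?_, ?_⟩)
    · apply Set.Subset.antisymm
      · intro v hv
        obtain ⟨y, hya, hyb, h⟩ := get v hv
        rw [uniq y hya hyb] at h
        exact h
      · have sa : (Fm ε).SameCycle x (rotc ε (inv x)) := by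
          have := Fm_inv ε (inv x)
          rw [inv_inv] at this
          exact sc_eq _ this
        have sb : (Fm ε).SameCycle (inv x) (rotc ε x) := sc_eq _ (Fm_inv ε x)
        rintro v (rfl | rfl)
        · exact ⟨⟨_, (sameFace_iff hk e ε _ _).2 hxa, rfl⟩,
            ⟨_, (sameFace_iff hk e ε _ _).2 (hxb.trans sb), rfl⟩⟩
        · exact ⟨⟨_, (sameFace_iff hk e ε _ _).2 (hxa.trans sa), rfl⟩,
            ⟨_, (sameFace_iff hk e ε _ _).2 hxb, rfl⟩⟩
    · apply Set.Subset.antisymm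
      · rintro f ⟨⟨d, hda, rfl⟩, ⟨d', hdb, hv⟩⟩
        obtain ⟨p, rfl⟩ := (toD_bij hk e).2 d
        obtain ⟨q, rfl⟩ := (toD_bij hk e).2 d'
        rw [sameFace_iff] at hda hdb
        rcases (toD_edge_iff hk e q p).1 hv with h | h
        · subst h
          exact absurd (hda.trans hdb.symm) hd
        · rw [h] at hdb
          rw [uniq p hda hdb]
          rfl
      · rintro f rfl
        refine ⟨⟨_, (sameFace_iff hk e ε _ _).2 hxa, rfl⟩,
          ⟨_, (sameFace_iff hk e ε _ _).2 hxb, ?_⟩⟩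
        rw [← toD_symm, SimpleGraph.Dart.edge_symm]
        rfl

lemma rot_surj (hk : 3 ≤ k) (e : V ≃ Vt k) (R : RotationSystem (gr e)) :
    ∃ ε, R.σ = (rot hk e ε).σ := by
  let τ : Equiv.Perm (Dt k) := (psi hk e).symm.permCongr R.σ
  have hτ : ∀ x, psi hk e (τ x) = R.σ (psi hk e x) := by
    intro x
    simp [τ, Equiv.permCongr_apply]
  have htail : ∀ x, (τ x).1 = x.1 := by
    intro x
    have h := R.tail_fixed (psi hk e x)
    rw [← hτ, psi_apply, psi_apply, toD_fst, toD_fst] at h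
    exact e.symm.injective h
  have hfix : ∀ x, τ x ≠ x := by
    intro x hx
    have hc : τ.SameCycle x (x.1, x.2 + 1) := by
      rw [sameCycle_transfer τ R.σ (psi hk e) hτ]
      exact R.orbit_tail _ _ rfl
    obtain ⟨n, hn⟩ := hc
    rw [Equiv.Perm.zpow_apply_eq_self_of_apply_eq_self hx] at hn
    have : x.2 = x.2 + 1 := congrArg Prod.snd hn
    revert this
    generalize x.2 = c
    revert c
    decide
  have key : ∀ f : Fin 3 → Fin 3, Function.Injective f → (∀ c, f c ≠ c) →
      (∀ c, f c = c + 1) ∨ (∀ c, f c = c - 1) := by decide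
  have hv : ∀ v : Vt k, ∃ b : Bool, ∀ c, (τ (v, c)).2 = if b then c + 1 else c - 1 := by
    intro v
    have i1 : Function.Injective (fun c => (τ (v, c)).2) := by
      intro c c' h
      have : τ (v, c) = τ (v, c') := Prod.ext (by rw [htail, htail]) h
      exact congrArg Prod.snd (τ.injective this)
    have i2 : ∀ c, (τ (v, c)).2 ≠ c := by
      intro c h
      exact hfix (v, c) (Prod.ext (htail _) h)
    rcases key (fun c => (τ (v, c)).2) i1 i2 with h | h
    · exact ⟨true, by simpa using h⟩
    · exact ⟨false, by simpa using h⟩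
  choose ε hε using hv
  refine ⟨ε, ?_⟩
  ext1 d
  obtain ⟨x, rfl⟩ := (psi hk e).surjective d
  change _ = (psi hk e).permCongr (rotc ε) _
  rw [psi_conj, ← hτ]
  exact congrArg _ (Prod.ext (htail x) (hε x.1 x.2))

lemma rot_mirror (hk : 3 ≤ k) (e : V ≃ Vt k) (ε : Vt k → Bool) :
    (rot hk e (fun v => !ε v)).σ = (rot hk e ε).σ⁻¹ := by
  rw [eq_inv_iff_mul_eq_one]
  ext1 d
  obtain ⟨x, rfl⟩ := (psi hk e).surjective d
  change (psi hk e).permCongr (rotc _) ((psi hk e).permCongr (rotc _) _) = _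
  rw [psi_conj, psi_conj]
  simp only [Equiv.Perm.coe_one, id_eq]
  congr 1
  obtain ⟨v, c⟩ := x
  cases h : ε v <;> simp [rotc, h]

lemma gr_cubic (hk : 3 ≤ k) (e : V ≃ Vt k) : (gr e).IsCubic := by
  intro v
  have : Function.Bijective
      (fun c : Fin 3 => (⟨e.symm (nb (e v) c), ⟨c, by simp⟩⟩ : (gr e).neighborSet v)) := by
    constructor
    · intro c c' h
      have := e.symm.injective (congrArg Subtype.val h)
      exact nb_inj hk _ this
    · rintro ⟨w, c, h⟩
      exact ⟨c, Subtype.ext (by simp [h])⟩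
  rw [← Nat.card_congr (Equiv.ofBijective _ this)]
  simp

lemma card_faces (hk : 3 ≤ k) (e : V ≃ Vt k) (ε : Vt k → Bool) {Λ : Type} (lab : Dt k → Λ)
    (hl : ∀ x y, (Fm ε).SameCycle x y ↔ lab x = lab y) (hs : Function.Surjective lab) :
    (rot hk e ε).numFaces = Nat.card Λ := by
  have hl' : ∀ d d', (rot hk e ε).SameFace d d' ↔
      lab ((psi hk e).symm d) = lab ((psi hk e).symm d') := by
    intro d d'
    obtain ⟨x, rfl⟩ := (psi hk e).surjective d
    obtain ⟨y, rfl⟩ := (psi hk e).surjective d'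
    rw [psi_apply, psi_apply, sameFace_iff, hl, ← psi_apply hk, ← psi_apply hk]
    simp
  apply Nat.card_eq_of_bijective
    (Quot.lift (fun d => lab ((psi hk e).symm d)) (fun a b h => (hl' a b).1 h))
  constructor
  · intro a b
    induction a using Quot.ind
    induction b using Quot.ind
    intro h
    exact Quot.sound ((hl' _ _).2 h)
  · intro l
    obtain ⟨x, rfl⟩ := hs l
    exact ⟨Quot.mk _ (psi hk e x), by simp⟩

lemma card_edges (hk : 3 ≤ k) (e : V ≃ Vt k) : Nat.card (gr e).edgeSet = 3 * k ^ 2 := by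
  classical
  haveI : NeZero k := ⟨by omega⟩
  have h1 := (gr e).dart_card_eq_twice_card_edges
  rw [← Fintype.card_congr (psi hk e)] at h1
  simp only [Fintype.card_prod, Fintype.card_bool, ZMod.card, Fintype.card_fin] at h1
  rw [Nat.card_eq_fintype_card, ← SimpleGraph.edgeFinset_card]
  nlinarith

end Transfer

end TorusHex

/-- For every `k ≥ 3` there is a cubic graph on `n = 2k²` vertices with a polyhedral
embedding of genus 1 and a polyhedral embedding of genus `(k² - 3k + 2)/2`, and with
no other polyhedral embedding up to mirror images. -/
theorem torus_and_high_genus_polyhedral (k : ℕ) (hk : 3 ≤ k) :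
    ∃ (G : SimpleGraph (Fin (2 * k ^ 2))) (R₁ R₂ : RotationSystem G) (g₂ : ℕ),
      G.IsCubic ∧
      R₁.Polyhedral ∧ R₁.HasGenus 1 ∧
      R₂.Polyhedral ∧ 2 * g₂ + 3 * k = k ^ 2 + 2 ∧ R₂.HasGenus g₂ ∧
      ∀ R : RotationSystem G, R.Polyhedral →
        R.σ = R₁.σ ∨ R.σ = (R₁.σ)⁻¹ ∨ R.σ = R₂.σ ∨ R.σ = (R₂.σ)⁻¹ := by
  haveI : NeZero k := ⟨by omega⟩
  have hc : Fintype.card (Fin (2 * k ^ 2)) = Fintype.card (TorusHex.Vt k) := by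
    simp only [Fintype.card_prod, Fintype.card_bool, ZMod.card, Fintype.card_fin]
    ring
  let e : Fin (2 * k ^ 2) ≃ TorusHex.Vt k := Fintype.equivOfCardEq hc
  have hg : ∃ g : ℕ, 2 * g + 3 * k = k ^ 2 + 2 := by
    obtain ⟨m, rfl⟩ : ∃ m, k = m + 2 := ⟨k - 2, by omega⟩
    obtain ⟨g, hg⟩ := Nat.even_mul_succ_self m
    exact ⟨g, by nlinarith⟩
  obtain ⟨g, hg⟩ := hg
  refine ⟨TorusHex.gr e, TorusHex.rot hk e TorusHex.ε1, TorusHex.rot hk e TorusHex.ε2, g,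
    TorusHex.gr_cubic hk e, TorusHex.poly_of_good hk e _ (TorusHex.good1 hk), ?_,
    TorusHex.poly_of_good hk e _ (TorusHex.good2 hk), hg, ?_, ?_⟩
  · unfold RotationSystem.HasGenus
    rw [TorusHex.card_edges hk, TorusHex.card_faces hk e _ _ TorusHex.same1 TorusHex.lab1_surj]
    simp only [Fintype.card_fin, Nat.card_eq_fintype_card, Fintype.card_prod, ZMod.card]
    push_cast
    ring
  · unfold RotationSystem.HasGenus
    rw [TorusHex.card_edges hk,
      TorusHex.card_faces hk e _ _ (TorusHex.same2 hk) TorusHex.lab2_surj]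
    simp only [Fintype.card_fin, Nat.card_eq_fintype_card, Fintype.card_prod, ZMod.card]
    zify at hg
    push_cast
    linarith
  · intro R hR
    obtain ⟨ε, hε⟩ := TorusHex.rot_surj hk e R
    have hRe : R = TorusHex.rot hk e ε := by
      cases R
      simp only at hε
      subst hε
      rfl
    rw [hRe] at hR
    rw [hε]
    rcases TorusHex.good_classify hk (TorusHex.good_of_poly hk e ε hR) with ⟨b, hb⟩ | ⟨b, hb⟩
    · cases b
      · right; left
        rw [← TorusHex.rot_mirror]
        congr 2
        funext v
        simp [hb, TorusHex.ε1]
      · left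
        congr 2
        funext v
        simp [hb, TorusHex.ε1]
    · cases b
      · right; right; right
        rw [← TorusHex.rot_mirror]
        congr 2
        funext v
        simp [hb, TorusHex.ε2]
      · right; right; left
        congr 2
        funext v
        simp [hb, TorusHex.ε2]
end

section
/- For every k > 0 there is a cubic graph G admitting two polyhedral embeddings P and P' such that genus(P') − genus(P) ≥ k and G has no polyhedral embedding whose genus lies strictly between genus(P) and genus(P'). -/
open SimpleGraph

namespace RotationSystem

section general

variable {V : Type*} [Fintype V] [DecidableEq V] {G : SimpleGraph V} (R : RotationSystem G)

theorem faceMap_symm (d : G.Dart) : R.faceMap d.symm = R.σ d := by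
  simp [faceMap, dartSymmPerm]

theorem faceMap_fst (d : G.Dart) : (R.faceMap d).fst = d.snd := by
  have h := R.tail_fixed d.symm
  simpa [faceMap, dartSymmPerm] using h

theorem sf_refl (d : G.Dart) : R.SameFace d d := Equiv.Perm.SameCycle.refl _ _

variable {R}

theorem sf_symm {d d' : G.Dart} (h : R.SameFace d d') : R.SameFace d' d :=
  Equiv.Perm.SameCycle.symm h

theorem sf_trans {d d' d'' : G.Dart} (h : R.SameFace d d') (h' : R.SameFace d' d'') :
    R.SameFace d d'' :=
  Equiv.Perm.SameCycle.trans h h'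

variable (R)

theorem sf_next (d : G.Dart) : R.SameFace d (R.faceMap d) :=
  ⟨1, by simp⟩

theorem sf_rot (d : G.Dart) : R.SameFace d.symm (R.σ d) := by
  have := R.sf_next d.symm
  rwa [faceMap_symm] at this

theorem tail_cases (h3 : ∀ d, R.σ (R.σ (R.σ d)) = d) {d d' : G.Dart} (h : d.fst = d'.fst) :
    d' = d ∨ d' = R.σ d ∨ d' = R.σ (R.σ d) := by
  have key : ∀ n : ℕ, (R.σ ^ n) d = d ∨ (R.σ ^ n) d = R.σ d ∨ (R.σ ^ n) d = R.σ (R.σ d) := by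
    intro n
    induction n with
    | zero => simp
    | succ n ih =>
      rw [pow_succ', Equiv.Perm.mul_apply]
      rcases ih with h | h | h
      · rw [h]; simp
      · rw [h]; simp
      · rw [h, h3]; simp
  have : Finite G.Dart := by
    classical
    infer_instance
  obtain ⟨n, hn⟩ := (R.orbit_tail d d' h).exists_nat_pow_eq
  rw [← hn]
  exact key n

/-- For rotation systems of cubic graphs, simplicity of the dual implies polyhedrality. -/
theorem polyhedral_of (h3 : ∀ d, R.σ (R.σ (R.σ d)) = d)
    (hA : ∀ d : G.Dart, ¬ R.SameFace d d.symm)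
    (hB : ∀ d d' : G.Dart, R.SameFace d d' → R.SameFace d.symm d'.symm → d = d') :
    R.Polyhedral := by
  have hS : R.FacesSimple := by
    intro d d' h ht
    rcases R.tail_cases h3 ht with e | e | e
    · exact e.symm
    · subst e
      exact absurd (sf_trans h (sf_symm (R.sf_rot d))) (hA d)
    · exfalso
      have e2 : R.σ d' = d := by rw [e, h3]
      have := R.sf_rot d'
      rw [e2] at this
      exact hA d' (sf_symm (sf_trans this h))
  refine ⟨hS, fun d d' hdd => ?_⟩
  -- common vertices yield common darts
  have key : ∀ v, v ∈ R.faceVerts d ∩ R.faceVerts d' →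
      ∃ x : G.Dart, R.SameFace d x ∧ R.SameFace d' x.symm ∧ (v = x.fst ∨ v = x.snd) := by
    rintro v ⟨⟨e, he, hev⟩, ⟨e', he', hev'⟩⟩
    rcases R.tail_cases h3 (hev.trans hev'.symm) with h | h | h
    · subst h
      exact absurd (sf_trans he (sf_symm he')) hdd
    · refine ⟨e, he, ?_, Or.inl hev.symm⟩
      subst h
      exact sf_trans he' (sf_symm (R.sf_rot e))
    · refine ⟨e'.symm, ?_, ?_, Or.inr hev'.symm⟩
      · have e2 : R.σ e' = e := by rw [h, h3]
        have := R.sf_rot e'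
        rw [e2] at this
        exact sf_trans he (sf_symm this)
      · simpa using he'
  have uniq : ∀ x y : G.Dart, R.SameFace d x → R.SameFace d' x.symm → R.SameFace d y →
      R.SameFace d' y.symm → x = y := fun x y h1 h2 h3 h4 =>
    hB x y (sf_trans (sf_symm h1) h3) (sf_trans (sf_symm h2) h4)
  by_cases hex : ∃ x : G.Dart, R.SameFace d x ∧ R.SameFace d' x.symm
  · obtain ⟨x, hx, hx'⟩ := hex
    right; right
    refine ⟨x.fst, x.snd, x.adj, ?_, ?_⟩
    · ext v
      constructor
      · intro hv
        obtain ⟨y, hy, hy', hvy⟩ := key v hv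
        rw [uniq x y hx hx' hy hy']
        exact hvy
      · rintro (rfl | rfl)
        · refine ⟨⟨x, hx, rfl⟩, ⟨R.faceMap x.symm, sf_trans hx' (R.sf_next _), ?_⟩⟩
          rw [faceMap_fst]; rfl
        · refine ⟨⟨R.faceMap x, sf_trans hx (R.sf_next _), R.faceMap_fst x⟩, ⟨x.symm, hx', rfl⟩⟩
    · ext s
      constructor
      · rintro ⟨⟨y, hy, rfl⟩, ⟨y', hy', he⟩⟩
        rcases SimpleGraph.dart_edge_eq_iff _ _ |>.1 he with h | h
        · subst h
          exact absurd (sf_trans hy (sf_symm hy')) hdd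
        · subst h
          rw [← uniq x y hx hx' hy hy']
          rfl
      · rintro rfl
        exact ⟨⟨x, hx, rfl⟩, ⟨x.symm, hx', x.edge_symm⟩⟩
  · left
    rw [Set.eq_empty_iff_forall_notMem]
    intro v hv
    obtain ⟨y, hy, hy', -⟩ := key v hv
    exact hex ⟨y, hy, hy'⟩

theorem adj_of_poly (hP : R.Polyhedral) {d d' : G.Dart} (h : ¬ R.SameFace d d') {v w : V}
    (hvw : v ≠ w) (h1 : v ∈ R.faceVerts d) (h2 : v ∈ R.faceVerts d') (h3 : w ∈ R.faceVerts d)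
    (h4 : w ∈ R.faceVerts d') : G.Adj v w := by
  have hv : v ∈ R.faceVerts d ∩ R.faceVerts d' := ⟨h1, h2⟩
  have hw : w ∈ R.faceVerts d ∩ R.faceVerts d' := ⟨h3, h4⟩
  rcases hP.2 d d' h with e | ⟨x, e, -⟩ | ⟨x, y, hxy, e, -⟩
  · rw [e] at hv; exact hv.elim
  · rw [e] at hv hw
    exact absurd (hv.trans hw.symm) hvw
  · rw [e] at hv hw
    rcases hv with rfl | rfl <;> rcases hw with rfl | rfl
    · exact absurd rfl hvw
    · exact hxy
    · exact hxy.symm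
    · exact absurd rfl hvw

/-- Two consecutive equal turns of a pentagon force all turns to be equal. -/
theorem pent_core (hP : R.Polyhedral) {x0 x1 x2 x3 x4 : G.Dart}
    (e2 : x2.snd = x3.fst)
    (e4 : x4.snd = x0.fst)
    (hne : x0.fst ≠ x3.fst) (hna : ¬ G.Adj x0.fst x3.fst) (hn : x4.symm ≠ x0)
    (p0 : R.faceMap x0 = x1) (p1 : R.faceMap x1 = x2)
    (p3 : R.faceMap x3 = x4 ∨ R.faceMap x4.symm = x3.symm) :
    R.faceMap x2 = x3 ∧ R.faceMap x3 = x4 ∧ R.faceMap x4 = x0 := by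
  have s1 : R.SameFace x0 x1 := p0 ▸ R.sf_next x0
  have s2 : R.SameFace x0 x2 := sf_trans s1 (p1 ▸ R.sf_next x1)
  have s3 : R.SameFace x0 (R.faceMap x2) := sf_trans s2 (R.sf_next x2)
  have t3 : (R.faceMap x2).fst = x3.fst := by rw [faceMap_fst, e2]
  rcases p3 with p3 | p3
  · have q4 : R.SameFace x3 x4 := p3 ▸ R.sf_next x3
    have q0 : R.SameFace x3 (R.faceMap x4) := sf_trans q4 (R.sf_next x4)
    have t0 : (R.faceMap x4).fst = x0.fst := by rw [faceMap_fst, e4]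
    have same : R.SameFace x0 x3 := by
      by_contra hc
      exact hna (R.adj_of_poly hP hc hne ⟨x0, R.sf_refl _, rfl⟩ ⟨_, q0, t0⟩ ⟨_, s3, t3⟩
        ⟨x3, R.sf_refl _, rfl⟩)
    refine ⟨?_, p3, ?_⟩
    · exact hP.1 _ _ (sf_trans (sf_symm s3) same) t3
    · exact hP.1 _ _ (sf_symm (sf_trans same q0)) t0
  · exfalso
    have q4 : R.SameFace x4.symm x3.symm := p3 ▸ R.sf_next x4.symm
    have q0 : R.SameFace x4.symm (R.faceMap x3.symm) := sf_trans q4 (R.sf_next _)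
    have t0 : (R.faceMap x3.symm).fst = x3.fst := by rw [faceMap_fst]; rfl
    have same : R.SameFace x0 x4.symm := by
      by_contra hc
      exact hna (R.adj_of_poly hP hc hne ⟨x0, R.sf_refl _, rfl⟩ ⟨x4.symm, R.sf_refl _, e4⟩
        ⟨_, s3, t3⟩ ⟨_, q0, t0⟩)
    exact hn (hP.1 _ _ (sf_symm same) e4)

/-- In a polyhedral embedding of a cubic graph all turns of a pentagon agree. -/
theorem pent_all (hP : R.Polyhedral) (x : Fin 5 → G.Dart) (b : Fin 5 → Bool)
    (hx : ∀ i, (x i).snd = (x (i + 1)).fst)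
    (hne : ∀ i, (x i).fst ≠ (x (i + 2)).fst)
    (hna : ∀ i, ¬ G.Adj (x i).fst (x (i + 2)).fst)
    (hb : ∀ i, b i = true ↔ R.faceMap (x i) = x (i + 1))
    (hb' : ∀ i, b i = false ↔ R.faceMap (x (i + 1)).symm = (x i).symm) :
    ∀ i, b i = b 0 := by
  have h5 : ∀ i : Fin 5, i + 3 + 2 = i ∧ i + 4 + 1 = i ∧ i + 2 + 1 = i + 3 ∧ i + 1 + 1 = i + 2
      ∧ i + 3 + 1 = i + 4 ∧ i + 1 + 3 = i + 4 ∧ i + 4 + 2 = i + 1 ∧ i + 1 + 2 = i + 3 := by decide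
  have hnn : ∀ i, (x (i + 1)).symm ≠ x i := by
    intro i h
    have h1 : (x i).fst = (x (i + 1)).snd := by rw [← h]; rfl
    have h2 := hx (i + 1)
    rw [(h5 i).2.2.2.1] at h2
    exact hne i (h1.trans h2)
  have core : ∀ i, b i = true → b (i + 1) = true → b (i + 2) = true := by
    intro i h0 h1
    obtain ⟨e1, e2, e3, e4, e5, e6, e7, e8⟩ := h5 i
    have hx2 := hx (i + 2)
    have hx4 := hx (i + 4)
    have hne3 := hne (i + 3)
    have hna3 := hna (i + 3)
    have hn4 := hnn (i + 4)
    have hb1 := (hb (i + 1)).1 h1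
    rw [hb, e3]
    rw [e1] at hne3 hna3
    rw [e2] at hn4 hx4
    rw [e3] at hx2
    rw [e4] at hb1
    refine (R.pent_core hP hx2 hx4 hne3.symm (fun h => hna3 h.symm) (fun h => hn4 ?_)
      ((hb i).1 h0) hb1 ?_).1
    · rw [← h]; simp
    · rw [← e5, ← hb, ← hb']
      cases b (i + 3) <;> simp
  have core' : ∀ i, b i = false → b (i + 1) = false → b (i + 4) = false := by
    intro i h0 h1
    obtain ⟨e1, e2, e3, e4, e5, e6, e7, e8⟩ := h5 i
    have hx2 := hx (i + 2)
    have hx4 := hx (i + 4)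
    have hne3 := hne (i + 3)
    have hna3 := hna (i + 3)
    have hn2 := hnn (i + 2)
    have hb1 := (hb' (i + 1)).1 h1
    rw [hb', e2]
    rw [e1] at hne3 hna3
    rw [e2] at hx4
    rw [e3] at hx2 hn2
    rw [e4] at hb1
    refine (R.pent_core hP (x0 := (x (i + 2)).symm) (x1 := (x (i + 1)).symm) (x2 := (x i).symm)
      (x3 := (x (i + 4)).symm) (x4 := (x (i + 3)).symm) hx4.symm hx2.symm ?_ ?_ (fun h => hn2 ?_)
      hb1 ((hb' i).1 h0) ?_).1
    · change (x (i + 2)).snd ≠ (x (i + 4)).snd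
      rw [hx2, hx4]; exact hne3
    · change ¬ G.Adj (x (i + 2)).snd (x (i + 4)).snd
      rw [hx2, hx4]; exact hna3
    · simp only [SimpleGraph.Dart.symm_symm] at h
      rw [h]; simp
    · simp only [SimpleGraph.Dart.symm_symm]
      rw [← e5, ← hb, ← hb']
      cases b (i + 3) <;> simp
  have fin : ∀ b : Fin 5 → Bool, (∀ i, b i = true → b (i + 1) = true → b (i + 2) = true) →
      (∀ i, b i = false → b (i + 1) = false → b (i + 4) = false) → ∀ i, b i = b 0 := by decide
  exact fin b core core'

end general

end RotationSystem
/-- Kinds of vertices. -/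
inductive Kd
  | u | a | w
  deriving DecidableEq

instance : Fintype Kd := ⟨{.u, .a, .w}, by intro x; cases x <;> simp⟩

/-- Ports at a vertex. -/
inductive Pt
  | p0 | p1 | p2
  deriving DecidableEq

instance : Fintype Pt := ⟨{.p0, .p1, .p2}, by intro x; cases x <;> simp⟩

/-- The next port. -/
def Pt.s : Pt → Pt
  | .p0 => .p1
  | .p1 => .p2
  | .p2 => .p0

namespace PG

abbrev VV (I : Type) := Kd × Bool × I

variable {I : Type} (g : Bool → Equiv.Perm I)

/-- The neighbour of a vertex at a port. -/
def N : VV I → Pt → VV I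
  | (.u, c, j), .p0 => (.a, c, j)
  | (.u, c, j), .p1 => (.w, c, j)
  | (.u, c, j), .p2 => (.a, c, (g c).symm j)
  | (.w, c, j), .p0 => (.u, c, j)
  | (.w, c, j), .p1 => (.w, c, g c j)
  | (.w, c, j), .p2 => (.w, c, (g c).symm j)
  | (.a, c, j), .p0 => (.u, c, g c j)
  | (.a, c, j), .p1 => (.u, c, j)
  | (.a, c, j), .p2 => (.a, !c, j)

/-- The port leading back. -/
def rp : Kd → Pt → Pt
  | .u, .p0 => .p1
  | .u, .p1 => .p0
  | .u, .p2 => .p0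
  | .w, .p0 => .p1
  | .w, .p1 => .p2
  | .w, .p2 => .p1
  | .a, .p0 => .p2
  | .a, .p1 => .p0
  | .a, .p2 => .p2

theorem N_rp (v : VV I) (k : Pt) : N g (N g v k) (rp v.1 k) = v := by
  obtain ⟨κ, c, j⟩ := v
  cases κ <;> cases k <;> simp [N, rp]

theorem rp_rp (v : VV I) (k : Pt) : rp (N g v k).1 (rp v.1 k) = k := by
  obtain ⟨κ, c, j⟩ := v
  cases κ <;> cases k <;> simp [N, rp]

/-- Absence of short cycles. -/
def NoShort : Prop := (∀ c j, g c j ≠ j) ∧ (∀ c j, g c (g c j) ≠ j)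

variable {g}

theorem NoShort.symm_ne (h : NoShort g) (c : Bool) (j : I) : (g c).symm j ≠ j := by
  intro e
  exact h.1 c j (by rw [Equiv.symm_apply_eq] at e; exact e.symm)

theorem NoShort.ne_symm (h : NoShort g) (c : Bool) (j : I) : (g c) j ≠ (g c).symm j := by
  intro e
  apply h.2 c j
  rw [e]; simp

theorem N_inj (h : NoShort g) (v : VV I) : Function.Injective (N g v) := by
  obtain ⟨κ, c, j⟩ := v
  intro k k' hk
  have h1 := h.symm_ne c j
  have h2 := h.ne_symm c j
  have h3 := h.1 c j
  cases κ <;> cases k <;> cases k' <;> simp_all [N, eq_comm]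

theorem N_ne (h : NoShort g) (v : VV I) (k : Pt) : N g v k ≠ v := by
  obtain ⟨κ, c, j⟩ := v
  have h1 := h.symm_ne c j
  have h3 := h.1 c j
  cases κ <;> cases k <;> simp_all [N]

variable (g)

/-- The cubic graph built from two permutations, with vertices renamed along `f`. -/
def gr {W : Type} (f : VV I ≃ W) (h : NoShort g) : SimpleGraph W where
  Adj x y := ∃ k, N g (f.symm x) k = f.symm y
  symm := ⟨by
    rintro x y ⟨k, hk⟩
    exact ⟨rp (f.symm x).1 k, by rw [← hk, N_rp]⟩⟩
  loopless := ⟨by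
    rintro x ⟨k, hk⟩
    exact N_ne h _ _ hk⟩

variable {W : Type} (f : VV I ≃ W) (h : NoShort g)

theorem adj_iff (v w : VV I) : (gr g f h).Adj (f v) (f w) ↔ ∃ k, N g v k = w := by
  simp [gr]

/-- The dart at a vertex and port. -/
def dt (d : VV I × Pt) : (gr g f h).Dart :=
  ⟨(f d.1, f (N g d.1 d.2)), (adj_iff g f h _ _).2 ⟨d.2, rfl⟩⟩

theorem dt_bij : Function.Bijective (dt g f h) := by
  constructor
  · rintro ⟨v, k⟩ ⟨v', k'⟩ e
    have e1 : f v = f v' := congrArg (fun d => d.fst) e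
    have e2 : f (N g v k) = f (N g v' k') := congrArg (fun d => d.snd) e
    have e1 := f.injective e1
    subst e1
    have := N_inj h v (f.injective e2)
    subst this
    rfl
  · rintro ⟨⟨x, y⟩, ⟨k, hk⟩⟩
    refine ⟨(f.symm x, k), ?_⟩
    apply SimpleGraph.Dart.ext
    simp [dt, hk]

/-- The dart model. -/
noncomputable def de : VV I × Pt ≃ (gr g f h).Dart := Equiv.ofBijective _ (dt_bij g f h)

theorem de_fst (d : VV I × Pt) : (de g f h d).fst = f d.1 := rfl

theorem de_snd (d : VV I × Pt) : (de g f h d).snd = f (N g d.1 d.2) := rfl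

/-- The reverse dart. -/
def rv (d : VV I × Pt) : VV I × Pt := (N g d.1 d.2, rp d.1.1 d.2)

theorem rv_rv (d : VV I × Pt) : rv g (rv g d) = d := by
  simp [rv, N_rp, rp_rp]

theorem de_symm (d : VV I × Pt) : (de g f h d).symm = de g f h (rv g d) := by
  apply SimpleGraph.Dart.ext
  simp [de, dt, rv, N_rp]

theorem cubic : (gr g f h).IsCubic := by
  intro x
  have : Function.Bijective (fun k : Pt =>
      (⟨f (N g (f.symm x) k), by simp [gr]⟩ : (gr g f h).neighborSet x)) := by
    constructor
    · intro k k' e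
      have e := congrArg Subtype.val e
      exact N_inj h _ (f.injective e)
    · rintro ⟨y, k, hk⟩
      exact ⟨k, by simp [hk]⟩
  rw [← Nat.card_eq_of_bijective _ this]
  simp only [Nat.card_eq_fintype_card]
  rfl

/-- Rotation of darts prescribed by signs. -/
def rot (S : VV I → Bool) (d : VV I × Pt) : VV I × Pt :=
  (d.1, bif S d.1 then d.2.s else d.2.s.s)

theorem rot3 (S : VV I → Bool) (d : VV I × Pt) : rot S (rot S (rot S d)) = d := by
  obtain ⟨v, k⟩ := d
  cases hS : S v <;> cases k <;> simp [rot, hS, Pt.s]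

variable [Fintype W] [DecidableEq W]

/-- The rotation system prescribed by signs. -/
noncomputable def RS (S : VV I → Bool) : RotationSystem (gr g f h) where
  σ := (de g f h).permCongr
    ⟨rot S, fun d => rot S (rot S d), fun d => rot3 S d, fun d => rot3 S d⟩
  tail_fixed d := by
    obtain ⟨d, rfl⟩ := (de g f h).surjective d
    simp [Equiv.permCongr_apply, de_fst, rot]
  orbit_tail d d' hd := by
    obtain ⟨⟨v, k⟩, rfl⟩ := (de g f h).surjective d
    obtain ⟨⟨v', k'⟩, rfl⟩ := (de g f h).surjective d'
    have := f.injective hd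
    simp only at this
    subst this
    have key : ∃ n : ℕ, (rot S)^[n] (v, k) = (v, k') := by
      cases hS : S v <;> cases k <;> cases k' <;>
      first
      | exact ⟨0, rfl⟩
      | (refine ⟨1, ?_⟩; simp [rot, hS, Pt.s]; done)
      | (refine ⟨2, ?_⟩; simp [rot, hS, Pt.s]; done)
    obtain ⟨n, hn⟩ := key
    refine ⟨n, ?_⟩
    rw [← hn, zpow_natCast]
    clear hn hd
    induction n with
    | zero => rfl
    | succ n ih =>
      rw [pow_succ', Equiv.Perm.mul_apply, ih, Function.iterate_succ_apply']
      simp [Equiv.permCongr_apply]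

/-- `R` has sign function `S`. -/
def HasSign (R : RotationSystem (gr g f h)) (S : VV I → Bool) : Prop :=
  ∀ d, R.σ (de g f h d) = de g f h (rot S d)

theorem RS_sign (S : VV I → Bool) : HasSign g f h (RS g f h S) S := by
  intro d
  simp [RS, Equiv.permCongr_apply]

theorem exists_sign (R : RotationSystem (gr g f h)) : ∃ S, HasSign g f h R S := by
  have hfix : ∀ d, R.σ d ≠ d := by
    intro d hd
    obtain ⟨⟨v, k⟩, rfl⟩ := (de g f h).surjective d
    have := (R.orbit_tail (de g f h (v, k)) (de g f h (v, k.s)) rfl).eq_of_left hd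
    have := (de g f h).injective this
    cases k <;> simp [Pt.s] at this
  have hk : ∀ v, ∃ F : Pt → Pt, ∀ k, R.σ (de g f h (v, k)) = de g f h (v, F k) := by
    intro v
    have : ∀ k, ∃ k', R.σ (de g f h (v, k)) = de g f h (v, k') := by
      intro k
      obtain ⟨⟨v', k'⟩, hd⟩ := (de g f h).surjective (R.σ (de g f h (v, k)))
      have h1 := R.tail_fixed (de g f h (v, k))
      rw [← hd] at h1
      have := f.injective h1
      simp only at this
      subst this
      exact ⟨k', hd.symm⟩
    choose F hF using this
    exact ⟨F, hF⟩
  choose F hF using hk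
  have perm : ∀ F : Pt → Pt, (∀ k, F k ≠ k) → (∀ k k', F k = F k' → k = k') →
      ∃ b : Bool, ∀ k, F k = bif b then k.s else k.s.s := by
    decide
  have : ∀ v, ∃ b : Bool, ∀ k, F v k = bif b then k.s else k.s.s := by
    intro v
    apply perm
    · intro k e
      apply hfix (de g f h (v, k))
      rw [hF, e]
    · intro k k' e
      have : R.σ (de g f h (v, k)) = R.σ (de g f h (v, k')) := by rw [hF, hF, e]
      have := (de g f h).injective (R.σ.injective this)
      simpa using this
  choose S hS using this
  refine ⟨S, ?_⟩
  rintro ⟨v, k⟩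
  rw [hF, hS]
  rfl

section
variable {g f h}
variable {R : RotationSystem (gr g f h)} {S : VV I → Bool}

theorem sign_faceMap (hS : HasSign g f h R S) (d : VV I × Pt) :
    R.faceMap (de g f h d) = de g f h (rot S (rv g d)) := by
  rw [← hS, ← de_symm]
  rfl

theorem sign_h3 (hS : HasSign g f h R S) (d) : R.σ (R.σ (R.σ d)) = d := by
  obtain ⟨d, rfl⟩ := (de g f h).surjective d
  rw [hS, hS, hS, rot3]

theorem sign_pent (hS : HasSign g f h R S) (hP : R.Polyhedral) (c : Bool) (j : I) :
    S (.w, c, j) = S (.u, c, j) ∧ S (.a, c, j) = S (.u, c, j) ∧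
    S (.u, c, g c j) = S (.u, c, j) := by
  have h1 := h.1 c j
  have h2 := h.2 c j
  have h3 := h.symm_ne c j
  have h4 := h.ne_symm c j
  have h5 : (g c).symm j ≠ g c j := fun e => h4 e.symm
  have h6 : j ≠ g c j := fun e => h1 e.symm
  have key := R.pent_all hP
    ![de g f h ((.u, c, j), .p1), de g f h ((.w, c, j), .p1), de g f h ((.w, c, g c j), .p0),
      de g f h ((.u, c, g c j), .p2), de g f h ((.a, c, j), .p1)]
    ![S (.w, c, j), S (.w, c, g c j), S (.u, c, g c j), S (.a, c, j), S (.u, c, j)]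
    ?_ ?_ ?_ ?_ ?_
  · have k2 := key 2
    have k3 := key 3
    have k4 := key 4
    simp at k2 k3 k4
    rw [k2, k3, k4]
    simp
  · intro i
    fin_cases i <;> simp [de_fst, de_snd, N]
  · intro i
    fin_cases i <;> simp [de_fst, h6, h1]
  · intro i
    have na : ∀ v w : VV I, (∀ k, N g v k ≠ w) → ¬ (gr g f h).Adj (f v) (f w) := by
      intro v w hk ha
      obtain ⟨k, hk'⟩ := (adj_iff g f h v w).1 ha
      exact hk k hk'
    fin_cases i
    · exact na (.u, c, j) (.w, c, g c j) (by intro k; cases k <;> simp [N, h6])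
    · exact na (.w, c, j) (.u, c, g c j) (by intro k; cases k <;> simp [N, h6])
    · exact na (.w, c, g c j) (.a, c, j) (by intro k; cases k <;> simp [N])
    · exact na (.u, c, g c j) (.u, c, j) (by intro k; cases k <;> simp [N])
    · exact na (.a, c, j) (.w, c, j) (by intro k; cases k <;> simp [N])
  · intro i
    fin_cases i <;> simp [sign_faceMap hS, rv, N, rot, rp, Pt.s] <;>
      (generalize S _ = b; cases b <;> decide)
  · intro i
    fin_cases i <;> simp [sign_faceMap hS, de_symm, rv_rv] <;> simp [rv, N, rot, rp, Pt.s] <;>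
      (generalize S _ = b; cases b <;> decide)

end

end PG
namespace PG

/-- Combinatorial description of the faces crossing between the two halves. -/
structure Cross {I C : Type} (h : Bool → Equiv.Perm I) (X : Bool → I → C) : Prop where
  step : ∀ c j, X c (h c j) = X (!c) j
  ne : ∀ c j, X c j ≠ X (!c) j
  inj : ∀ c c' j j', X c j = X c' j' → X (!c) j = X (!c') j' → c = c' ∧ j = j'
  conn : ∀ r : Setoid (Bool × I), (∀ c j, r (!c, j) (c, h c j)) →
    ∀ c c' j j', X c j = X c' j' → r (c, j) (c', j')
  surj : ∀ x, ∃ c j, X c j = x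

theorem Cross.mirror {I C : Type} {h : Bool → Equiv.Perm I} {X : Bool → I → C} (hX : Cross h X) :
    Cross (fun c => (h c).symm) (fun c => X (!c)) where
  step c j := by
    have := hX.step c ((h c).symm j)
    simp at this
    simp [this]
  ne c j := hX.ne (!c) j
  inj c c' j j' h1 h2 := by
    have := hX.inj _ _ _ _ h1 h2
    simpa using this
  conn r hr c c' j j' e := by
    have hr' : ∀ c j, r (c, j) (!c, h c j) := by
      intro c j
      have := hr c (h c j)
      simp only [Equiv.symm_apply_apply] at this
      exact r.symm this
    have key := hX.conn ⟨fun p q => r (!p.1, p.2) (!q.1, q.2), fun p => r.refl _,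
      fun h => r.symm h, fun h h' => r.trans h h'⟩ (fun c j => by
        change r (!!c, j) (!c, h c j)
        simpa using hr' c j) (!c) (!c') j j' e
    change r (!!c, j) (!!c', j') at key
    simpa using key
  surj x := by
    obtain ⟨c, j, h⟩ := hX.surj x
    exact ⟨!c, j, by simpa using h⟩

/-- Labels of faces. -/
inductive Lab (I C : Type)
  | P (c : Bool) (j : I)
  | W (c : Bool)
  | X (x : C)

/-- The face label of a dart. -/
def lab {I C : Type} (g : Bool → Equiv.Perm I) (s : Bool → Bool) (X : Bool → I → C) :
    VV I × Pt → Lab I C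
  | ((.u, c, j), .p0) => bif s c then .X (X c j) else .P c j
  | ((.u, c, j), .p1) => bif s c then .P c j else .P c ((g c).symm j)
  | ((.u, c, j), .p2) => bif s c then .P c ((g c).symm j) else .X (X c ((g c).symm j))
  | ((.w, c, j), .p0) => bif s c then .P c ((g c).symm j) else .P c j
  | ((.w, c, j), .p1) => bif s c then .P c j else .W c
  | ((.w, c, j), .p2) => bif s c then .W c else .P c ((g c).symm j)
  | ((.a, c, j), .p0) => bif s c then .X (X (!c) j) else .P c j
  | ((.a, c, j), .p1) => bif s c then .P c j else .X (X (!c) j)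
  | ((.a, c, j), .p2) => .X (X c j)

/-- Permutations adjusted by signs. -/
def hs {I : Type} (g : Bool → Equiv.Perm I) (s : Bool → Bool) (c : Bool) : Equiv.Perm I :=
  bif s c then g c else (g c).symm

section
variable {I C : Type} {g : Bool → Equiv.Perm I} {s : Bool → Bool} {X : Bool → I → C}

/-- Signs that are constant on each half. -/
def sg (I : Type) (s : Bool → Bool) : VV I → Bool := fun v => s v.2.1

theorem lab_rot (hX : Cross (hs g s) X) (d : VV I × Pt) :
    lab g s X (rot (sg I s) d) = lab g s X (rv g d) := by
  obtain ⟨⟨κ, c, j⟩, k⟩ := d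
  have h1 := hX.step c j
  have h2 := hX.step c ((g c).symm j)
  cases hc : s c <;> cases κ <;> cases k <;>
    simp_all [rot, sg, lab, rv, N, rp, Pt.s, hs]

theorem lab_ne (h : NoShort g) (hX : Cross (hs g s) X) (d : VV I × Pt) :
    lab g s X (rot (sg I s) d) ≠ lab g s X d := by
  obtain ⟨⟨κ, c, j⟩, k⟩ := d
  have h1 := hX.ne c j
  have h2 := h.symm_ne c j
  cases hc : s c <;> cases κ <;> cases k <;>
    simp [rot, sg, lab, Pt.s, hc] <;> first | exact h1 | exact Ne.symm h1 | exact h2 | exact Ne.symm h2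

theorem lab_inj (h : NoShort g) (hX : Cross (hs g s) X) (d d' : VV I × Pt)
    (e : lab g s X d = lab g s X d')
    (e' : lab g s X (rot (sg I s) d) = lab g s X (rot (sg I s) d')) : d = d' := by
  obtain ⟨⟨κ, c, j⟩, k⟩ := d
  obtain ⟨⟨κ', c', j'⟩, k'⟩ := d'
  have h1 := hX.ne c j
  have h1' := hX.ne c j'
  have h2 := h.symm_ne c j
  have h3 := h.ne_symm c j
  have h3' := h.ne_symm c j'
  have h4 := hX.step c j
  have h4' := hX.step c j'
  have h5 := hX.inj c c' j j'
  by_cases hcc : c = c'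
  · subst hcc
    clear hX h
    cases hc : s c <;> cases κ <;> cases k <;> cases κ' <;> cases k' <;>
      simp [lab, rot, sg, Pt.s, hc, hs] at e e' h4 h4' <;> grind
  · clear hX h
    cases hc : s c <;> cases hc' : s c' <;> cases κ <;> cases k <;> cases κ' <;> cases k' <;>
      simp [lab, rot, sg, Pt.s, hc, hc'] at e e' <;> grind

end

end PG
namespace PG

section faces

variable {I C : Type} {g : Bool → Equiv.Perm I} {s : Bool → Bool} {X : Bool → I → C}

/-- Transitivity of the permutations. -/
def Trans (g : Bool → Equiv.Perm I) : Prop :=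
  ∀ c, ∀ r : Setoid I, (∀ j, r j (g c j)) → ∀ j j', r j j'

/-- Every dart is related to a standard dart of its face. -/
theorem lab_std (r : Setoid (VV I × Pt))
    (T : ∀ d, r (rv g d) (rot (sg I s) d)) (d : VV I × Pt) :
    (∃ c j, lab g s X d = .P c j ∧ r d ((.a, c, j), bif s c then .p1 else .p0)) ∨
    (∃ c j, lab g s X d = .W c ∧ r d ((.w, c, j), bif s c then .p2 else .p1)) ∨
    (∃ c j, lab g s X d = .X (X c j) ∧ r d ((.a, c, j), .p2)) := by
  obtain ⟨⟨κ, c, j⟩, k⟩ := d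
  cases hc : s c
  · have t1 : ∀ j, r ((.u, c, j), .p0) ((.a, c, j), .p0) := fun j => by
      simpa [rv, N, rp, rot, sg, hc, Pt.s] using T ((.a, c, j), .p1)
    have t2 : ∀ j, r ((.w, c, j), .p0) ((.u, c, j), .p0) := fun j => by
      simpa [rv, N, rp, rot, sg, hc, Pt.s] using T ((.u, c, j), .p1)
    have t3 : ∀ j, r ((.w, c, j), .p2) ((.w, c, (g c).symm j), .p0) := fun j => by
      simpa [rv, N, rp, rot, sg, hc, Pt.s] using T ((.w, c, (g c).symm j), .p1)
    have t4 : ∀ j, r ((.u, c, j), .p1) ((.w, c, j), .p2) := fun j => by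
      simpa [rv, N, rp, rot, sg, hc, Pt.s] using T ((.w, c, j), .p0)
    have t5 : ∀ j, r ((.u, c, j), .p2) ((.a, c, (g c).symm j), .p2) := fun j => by
      simpa [rv, N, rp, rot, sg, hc, Pt.s] using T ((.a, c, (g c).symm j), .p0)
    have t6 : ∀ j, r ((.a, !c, j), .p2) ((.a, c, j), .p1) := fun j => by
      simpa [rv, N, rp, rot, sg, hc, Pt.s] using T ((.a, c, j), .p2)
    have q2 : ∀ j, r ((.w, c, j), .p0) ((.a, c, j), .p0) := fun j => r.trans (t2 j) (t1 j)
    have q3 : ∀ j, r ((.w, c, j), .p2) ((.a, c, (g c).symm j), .p0) :=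
      fun j => r.trans (t3 j) (q2 _)
    have q4 : ∀ j, r ((.u, c, j), .p1) ((.a, c, (g c).symm j), .p0) :=
      fun j => r.trans (t4 j) (q3 _)
    cases κ <;> cases k
    · exact Or.inl ⟨c, j, by simp [lab, hc], by simpa [hc] using t1 j⟩
    · exact Or.inl ⟨c, (g c).symm j, by simp [lab, hc], by simpa [hc] using q4 j⟩
    · exact Or.inr (Or.inr ⟨c, (g c).symm j, by simp [lab, hc], t5 j⟩)
    · exact Or.inl ⟨c, j, by simp [lab, hc], by simpa [hc] using r.refl _⟩
    · exact Or.inr (Or.inr ⟨!c, j, by simp [lab, hc], r.symm (t6 j)⟩)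
    · exact Or.inr (Or.inr ⟨c, j, by simp [lab], r.refl _⟩)
    · exact Or.inl ⟨c, j, by simp [lab, hc], by simpa [hc] using q2 j⟩
    · exact Or.inr (Or.inl ⟨c, j, by simp [lab, hc], by simpa [hc] using r.refl _⟩)
    · exact Or.inl ⟨c, (g c).symm j, by simp [lab, hc], by simpa [hc] using q3 j⟩
  · have t1 : ∀ j, r ((.u, c, j), .p1) ((.w, c, j), .p1) := fun j => by
      simpa [rv, N, rp, rot, sg, hc, Pt.s] using T ((.w, c, j), .p0)
    have t2 : ∀ j, r ((.w, c, j), .p1) ((.w, c, g c j), .p0) := fun j => by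
      simpa [rv, N, rp, rot, sg, hc, Pt.s] using T ((.w, c, g c j), .p2)
    have t3 : ∀ j, r ((.w, c, j), .p0) ((.u, c, j), .p2) := fun j => by
      simpa [rv, N, rp, rot, sg, hc, Pt.s] using T ((.u, c, j), .p1)
    have t4 : ∀ j, r ((.u, c, j), .p2) ((.a, c, (g c).symm j), .p1) := fun j => by
      simpa [rv, N, rp, rot, sg, hc, Pt.s] using T ((.a, c, (g c).symm j), .p0)
    have t5 : ∀ j, r ((.u, c, j), .p0) ((.a, c, j), .p2) := fun j => by
      simpa [rv, N, rp, rot, sg, hc, Pt.s] using T ((.a, c, j), .p1)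
    have t6 : ∀ j, r ((.a, !c, j), .p2) ((.a, c, j), .p0) := fun j => by
      simpa [rv, N, rp, rot, sg, hc, Pt.s] using T ((.a, c, j), .p2)
    have q3 : ∀ j, r ((.w, c, j), .p0) ((.a, c, (g c).symm j), .p1) :=
      fun j => r.trans (t3 j) (t4 j)
    have q2 : ∀ j, r ((.w, c, j), .p1) ((.a, c, j), .p1) :=
      fun j => by simpa using r.trans (t2 j) (q3 _)
    have q1 : ∀ j, r ((.u, c, j), .p1) ((.a, c, j), .p1) := fun j => r.trans (t1 j) (q2 j)
    cases κ <;> cases k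
    · exact Or.inr (Or.inr ⟨c, j, by simp [lab, hc], t5 j⟩)
    · exact Or.inl ⟨c, j, by simp [lab, hc], by simpa [hc] using q1 j⟩
    · exact Or.inl ⟨c, (g c).symm j, by simp [lab, hc], by simpa [hc] using t4 j⟩
    · exact Or.inr (Or.inr ⟨!c, j, by simp [lab, hc], r.symm (t6 j)⟩)
    · exact Or.inl ⟨c, j, by simp [lab, hc], by simpa [hc] using r.refl _⟩
    · exact Or.inr (Or.inr ⟨c, j, by simp [lab], r.refl _⟩)
    · exact Or.inl ⟨c, (g c).symm j, by simp [lab, hc], by simpa [hc] using q3 j⟩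
    · exact Or.inl ⟨c, j, by simp [lab, hc], by simpa [hc] using q2 j⟩
    · exact Or.inr (Or.inl ⟨c, j, by simp [lab, hc], by simpa [hc] using r.refl _⟩)

/-- Any equivalence relation on darts compatible with faces relates darts with equal labels. -/
theorem lab_conn (hT : Trans g) (hX : Cross (hs g s) X) (r : Setoid (VV I × Pt))
    (T : ∀ d, r (rv g d) (rot (sg I s) d)) (d d' : VV I × Pt)
    (e : lab g s X d = lab g s X d') : r d d' := by
  have hW : ∀ c j j', r ((.w, c, j), bif s c then .p2 else .p1)
      ((.w, c, j'), bif s c then .p2 else .p1) := by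
    intro c
    refine hT c ⟨fun j j' => r ((.w, c, j), bif s c then .p2 else .p1)
      ((.w, c, j'), bif s c then .p2 else .p1), fun _ => r.refl _, fun h => r.symm h,
      fun h h' => r.trans h h'⟩ ?_
    intro j
    change r ((.w, c, j), bif s c then .p2 else .p1) ((.w, c, g c j), bif s c then .p2 else .p1)
    cases hc : s c
    · simpa [rv, N, rp, rot, sg, hc, Pt.s] using T ((.w, c, g c j), .p2)
    · apply r.symm
      simpa [rv, N, rp, rot, sg, hc, Pt.s] using T ((.w, c, j), .p1)
  have hC : ∀ c c' j j', X c j = X c' j' → r ((.a, c, j), .p2) ((.a, c', j'), .p2) := by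
    refine hX.conn ⟨fun p q => r ((.a, p.1, p.2), .p2) ((.a, q.1, q.2), .p2), fun _ => r.refl _,
      fun h => r.symm h, fun h h' => r.trans h h'⟩ ?_
    intro c j
    change r ((.a, !c, j), .p2) ((.a, c, hs g s c j), .p2)
    cases hc : s c
    · have a1 : r ((.a, !c, j), .p2) ((.a, c, j), .p1) := by
        simpa [rv, N, rp, rot, sg, hc, Pt.s] using T ((.a, c, j), .p2)
      have a2 : r ((.a, c, j), .p1) ((.u, c, j), .p2) := by
        simpa [rv, N, rp, rot, sg, hc, Pt.s] using T ((.u, c, j), .p0)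
      have a3 : r ((.u, c, j), .p2) ((.a, c, (g c).symm j), .p2) := by
        simpa [rv, N, rp, rot, sg, hc, Pt.s] using T ((.a, c, (g c).symm j), .p0)
      simpa [hs, hc] using r.trans a1 (r.trans a2 a3)
    · have a1 : r ((.a, !c, j), .p2) ((.a, c, j), .p0) := by
        simpa [rv, N, rp, rot, sg, hc, Pt.s] using T ((.a, c, j), .p2)
      have a2 : r ((.a, c, j), .p0) ((.u, c, g c j), .p0) := by
        simpa [rv, N, rp, rot, sg, hc, Pt.s] using T ((.u, c, g c j), .p2)
      have a3 : r ((.u, c, g c j), .p0) ((.a, c, g c j), .p2) := by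
        simpa [rv, N, rp, rot, sg, hc, Pt.s] using T ((.a, c, g c j), .p1)
      simpa [hs, hc] using r.trans a1 (r.trans a2 a3)
  rcases lab_std (X := X) r T d with ⟨c, j, l, q⟩ | ⟨c, j, l, q⟩ | ⟨c, j, l, q⟩ <;>
  rcases lab_std (X := X) r T d' with ⟨c', j', l', q'⟩ | ⟨c', j', l', q'⟩ | ⟨c', j', l', q'⟩ <;>
  rw [l, l'] at e <;> simp at e
  · obtain ⟨rfl, rfl⟩ := e
    exact r.trans q (r.symm q')
  · subst e
    exact r.trans q (r.trans (hW c j j') (r.symm q'))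
  · exact r.trans q (r.trans (hC c c' j j' e) (r.symm q'))

end faces

section count

variable {I C : Type} {g : Bool → Equiv.Perm I} {s : Bool → Bool} {X : Bool → I → C}
variable {W : Type} {f : VV I ≃ W} {h : NoShort g} [Fintype W] [DecidableEq W]
variable {R : RotationSystem (gr g f h)}

theorem sf_iff (hS : HasSign g f h R (sg I s)) (hT : Trans g) (hX : Cross (hs g s) X)
    (d d' : VV I × Pt) :
    R.SameFace (de g f h d) (de g f h d') ↔ lab g s X d = lab g s X d' := by
  constructor
  · intro hd
    have : Finite (gr g f h).Dart := by
      classical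
      infer_instance
    obtain ⟨n, hn⟩ := hd.exists_nat_pow_eq
    have key : ∀ n : ℕ, lab g s X ((de g f h).symm ((R.faceMap ^ n) (de g f h d))) =
        lab g s X d := by
      intro n
      induction n with
      | zero => simp
      | succ n ih =>
        rw [pow_succ', Equiv.Perm.mul_apply, ← ih]
        obtain ⟨y, hy⟩ := (de g f h).surjective ((R.faceMap ^ n) (de g f h d))
        rw [← hy, sign_faceMap hS, Equiv.symm_apply_apply, Equiv.symm_apply_apply,
          lab_rot hX, rv_rv]
    rw [← key n, hn, Equiv.symm_apply_apply]
  · intro e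
    refine lab_conn hT hX ⟨fun d d' => R.SameFace (de g f h d) (de g f h d'),
      fun _ => R.sf_refl _, fun h => RotationSystem.sf_symm h,
      fun h h' => RotationSystem.sf_trans h h'⟩ ?_ d d' e
    intro d
    change R.SameFace (de g f h (rv g d)) (de g f h (rot (sg I s) d))
    rw [← hS, ← de_symm]
    exact R.sf_rot _

theorem poly (hS : HasSign g f h R (sg I s)) (hT : Trans g) (hX : Cross (hs g s) X) :
    R.Polyhedral := by
  apply R.polyhedral_of (sign_h3 hS)
  · intro d
    obtain ⟨d, rfl⟩ := (de g f h).surjective d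
    rw [de_symm, sf_iff hS hT hX, ← lab_rot hX]
    exact fun e => lab_ne h hX d e.symm
  · intro d d'
    obtain ⟨d, rfl⟩ := (de g f h).surjective d
    obtain ⟨d', rfl⟩ := (de g f h).surjective d'
    rw [de_symm, de_symm, sf_iff hS hT hX, sf_iff hS hT hX, ← lab_rot hX, ← lab_rot hX]
    intro e e'
    rw [lab_inj h hX d d' e e']

theorem lab_surj [Nonempty I] (hX : Cross (hs g s) X) : Function.Surjective (lab g s X) := by
  rintro (⟨c, j⟩ | c | x)
  · cases hc : s c
    · exact ⟨((.a, c, j), .p0), by simp [lab, hc]⟩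
    · exact ⟨((.a, c, j), .p1), by simp [lab, hc]⟩
  · obtain ⟨j⟩ := ‹Nonempty I›
    cases hc : s c
    · exact ⟨((.w, c, j), .p1), by simp [lab, hc]⟩
    · exact ⟨((.w, c, j), .p2), by simp [lab, hc]⟩
  · obtain ⟨c, j, e⟩ := hX.surj x
    exact ⟨((.a, c, j), .p2), by simp [lab, e]⟩

/-- Labels as a sum type. -/
def labEquiv (I C : Type) : Lab I C ≃ (Bool × I) ⊕ (Bool ⊕ C) where
  toFun
    | .P c j => .inl (c, j)
    | .W c => .inr (.inl c)
    | .X x => .inr (.inr x)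
  invFun
    | .inl (c, j) => .P c j
    | .inr (.inl c) => .W c
    | .inr (.inr x) => .X x
  left_inv := by rintro (_ | _ | _) <;> rfl
  right_inv := by rintro (_ | _ | _) <;> rfl

theorem numFaces_eq [Nonempty I] [Finite I] [Finite C] (hS : HasSign g f h R (sg I s))
    (hT : Trans g) (hX : Cross (hs g s) X) :
    R.numFaces = 2 * Nat.card I + 2 + Nat.card C := by
  have hb : Function.Bijective (Quot.lift (fun d => lab g s X ((de g f h).symm d))
      (by
        intro d d' hd
        obtain ⟨d, rfl⟩ := (de g f h).surjective d
        obtain ⟨d', rfl⟩ := (de g f h).surjective d'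
        simpa using (sf_iff hS hT hX d d').1 hd) : Quot R.SameFace → Lab I C) := by
    constructor
    · rintro ⟨d⟩ ⟨d'⟩ e
      obtain ⟨d, rfl⟩ := (de g f h).surjective d
      obtain ⟨d', rfl⟩ := (de g f h).surjective d'
      apply Quot.sound
      rw [sf_iff hS hT hX]
      simpa using e
    · intro l
      obtain ⟨d, rfl⟩ := lab_surj hX l
      exact ⟨Quot.mk _ (de g f h d), by simp⟩
  rw [RotationSystem.numFaces, Nat.card_eq_of_bijective _ hb, Nat.card_congr (labEquiv I C),
    Nat.card_sum, Nat.card_sum, Nat.card_prod]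
  simp
  ring

theorem card_edges [Finite I] : Nat.card (gr g f h).edgeSet = 9 * Nat.card I := by
  classical
  have : Fintype I := Fintype.ofFinite I
  have h1 := (gr g f h).dart_card_eq_twice_card_edges
  have h2 : Fintype.card (gr g f h).Dart = 18 * Nat.card I := by
    rw [← Fintype.card_congr (de g f h)]
    simp only [Fintype.card_prod, Nat.card_eq_fintype_card]
    have : Fintype.card Kd = 3 := rfl
    have : Fintype.card Pt = 3 := rfl
    simp [*]
    ring
  rw [Nat.card_eq_fintype_card, ← SimpleGraph.edgeFinset_card]
  omega

theorem card_verts (f : VV I ≃ W) [Finite I] : Fintype.card W = 6 * Nat.card I := by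
  have : Fintype I := Fintype.ofFinite I
  rw [← Fintype.card_congr f]
  have : Fintype.card Kd = 3 := rfl
  simp [*]
  ring

end count

end PG
namespace PG

/-- Reduction of `Cross` to a single labelling. -/
theorem mkCross {I C : Type} (h : Bool → Equiv.Perm I) (Y : I → C)
    (h1 : ∀ i, Y (h true (h false i)) = Y i)
    (h2 : ∀ i, Y (h false i) ≠ Y i)
    (h3 : ∀ i i', Y i = Y i' → Y (h false i) = Y (h false i') → i = i')
    (h4 : ∀ i i', Y (h false i) = Y i' → Y i = Y (h false i') → False)
    (h5 : ∀ r : Setoid I, (∀ i, r i (h true (h false i))) → ∀ i i', Y i = Y i' → r i i')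
    (h6 : Function.Surjective Y) :
    Cross h (fun c j => bif c then Y j else Y ((h false).symm j)) where
  step c j := by
    obtain ⟨i, rfl⟩ := (h false).surjective j
    cases c
    · simp
    · simpa using h1 i
  ne c j := by
    obtain ⟨i, rfl⟩ := (h false).surjective j
    cases c
    · simpa using (h2 i).symm
    · simpa using h2 i
  inj c c' j j' e e' := by
    obtain ⟨i, rfl⟩ := (h false).surjective j
    obtain ⟨i', rfl⟩ := (h false).surjective j'
    cases c <;> cases c' <;> simp at e e'
    · simpa using h3 i i' e e'
    · exact (h4 i i' e' e).elim
    · exact (h4 i i' e e').elim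
    · simpa using h3 i i' e' e
  conn r hr c c' j j' e := by
    have t0 : ∀ j, r (true, j) (false, h false j) := fun j => hr false j
    have t1 : ∀ j, r (false, j) (true, h true j) := fun j => hr true j
    have key := h5 ⟨fun i i' => r (true, i) (true, i'), fun _ => r.refl _, fun h => r.symm h,
      fun h h' => r.trans h h'⟩ (fun i => r.trans (t0 i) (t1 _))
    have key : ∀ i i', Y i = Y i' → r (true, i) (true, i') := key
    obtain ⟨i, rfl⟩ := (h false).surjective j
    obtain ⟨i', rfl⟩ := (h false).surjective j'
    cases c <;> cases c' <;> simp at e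
    · exact r.trans (r.symm (t0 _)) (r.trans (key _ _ e) (t0 _))
    · exact r.trans (r.symm (t0 _)) (key _ _ e)
    · exact r.trans (key _ _ e) (t0 _)
    · exact key _ _ e
  surj x := by
    obtain ⟨i, hi⟩ := h6 x
    exact ⟨true, i, by simpa using hi⟩

/-- Eight positions. -/
inductive E8
  | e0 | e1 | e2 | e3 | e4 | e5 | e6 | e7

/-- Positions are numbered. -/
def e8 : E8 ≃ Fin 8 where
  toFun
    | .e0 => 0 | .e1 => 1 | .e2 => 2 | .e3 => 3 | .e4 => 4 | .e5 => 5 | .e6 => 6 | .e7 => 7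
  invFun
    | 0 => .e0 | 1 => .e1 | 2 => .e2 | 3 => .e3 | 4 => .e4 | 5 => .e5 | 6 => .e6 | 7 => .e7
  left_inv := by rintro (_ | _) <;> rfl
  right_inv := by intro i; fin_cases i <;> rfl

instance : Finite E8 := Finite.of_equiv _ e8.symm

instance : Nonempty E8 := ⟨.e0⟩

section
variable (Q : Type) [CommRing Q]

/-- First permutation. -/
def al : Equiv.Perm (E8 × Q) where
  toFun
    | (.e0, q) => (.e1, q)
    | (.e1, q) => (.e2, q)
    | (.e2, q) => (.e3, q)
    | (.e3, q) => (.e4, q)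
    | (.e4, q) => (.e5, q)
    | (.e5, q) => (.e6, q)
    | (.e6, q) => (.e7, q)
    | (.e7, q) => (.e0, q + 1)
  invFun
    | (.e0, q) => (.e7, q - 1)
    | (.e1, q) => (.e0, q)
    | (.e2, q) => (.e1, q)
    | (.e3, q) => (.e2, q)
    | (.e4, q) => (.e3, q)
    | (.e5, q) => (.e4, q)
    | (.e6, q) => (.e5, q)
    | (.e7, q) => (.e6, q)
  left_inv := by rintro ⟨_ | _, q⟩ <;> simp
  right_inv := by rintro ⟨_ | _, q⟩ <;> simp

/-- Second permutation. -/
def be : Equiv.Perm (E8 × Q) where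
  toFun
    | (.e0, q) => (.e6, q)
    | (.e1, q) => (.e0, q + 1)
    | (.e2, q) => (.e5, q - 1)
    | (.e3, q) => (.e7, q - 1)
    | (.e4, q) => (.e3, q + 1)
    | (.e5, q) => (.e1, q)
    | (.e6, q) => (.e4, q + 1)
    | (.e7, q) => (.e2, q)
  invFun
    | (.e0, q) => (.e1, q - 1)
    | (.e1, q) => (.e5, q)
    | (.e2, q) => (.e7, q)
    | (.e3, q) => (.e4, q - 1)
    | (.e4, q) => (.e6, q - 1)
    | (.e5, q) => (.e2, q + 1)
    | (.e6, q) => (.e0, q)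
    | (.e7, q) => (.e3, q + 1)
  left_inv := by rintro ⟨_ | _, q⟩ <;> simp
  right_inv := by rintro ⟨_ | _, q⟩ <;> simp

/-- Both permutations. -/
def gg : Bool → Equiv.Perm (E8 × Q) := fun c => bif c then be Q else al Q

variable {Q}

theorem gg_short : NoShort (gg Q) := by
  constructor <;> rintro (_ | _) ⟨_ | _, q⟩ <;> simp [gg, al, be]

/-- `Q` is generated by one. -/
def Gen (Q : Type) [CommRing Q] : Prop :=
  ∀ r : Setoid Q, (∀ q, r q (q + 1)) → ∀ q q', r q q'

theorem gg_trans (hQ : Gen Q) : Trans (gg Q) := by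
  rintro c r hr
  have t : ∀ {x y z}, r x y → r y z → r x z := fun h h' => r.trans h h'
  have main : (∀ q, r (.e0, q) (.e0, q + 1)) → (∀ j, ∃ q, r j (.e0, q)) → ∀ j j', r j j' := by
    intro h1 h2 j j'
    have h3 := hQ ⟨fun q q' => r (.e0, q) (.e0, q'), fun _ => r.refl _, fun h => r.symm h,
      fun h h' => r.trans h h'⟩ h1
    have h3 : ∀ q q', r (.e0, q) (.e0, q') := h3
    obtain ⟨q, hq⟩ := h2 j
    obtain ⟨q', hq'⟩ := h2 j'
    exact t hq (t (h3 _ _) (r.symm hq'))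
  cases c
  · have hr : ∀ j, r j (al Q j) := hr
    have a0 : ∀ q, r (.e0, q) (.e1, q) := fun q => hr (.e0, q)
    have a1 : ∀ q, r (.e1, q) (.e2, q) := fun q => hr (.e1, q)
    have a2 : ∀ q, r (.e2, q) (.e3, q) := fun q => hr (.e2, q)
    have a3 : ∀ q, r (.e3, q) (.e4, q) := fun q => hr (.e3, q)
    have a4 : ∀ q, r (.e4, q) (.e5, q) := fun q => hr (.e4, q)
    have a5 : ∀ q, r (.e5, q) (.e6, q) := fun q => hr (.e5, q)
    have a6 : ∀ q, r (.e6, q) (.e7, q) := fun q => hr (.e6, q)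
    have a7 : ∀ q, r (.e7, q) (.e0, q + 1) := fun q => hr (.e7, q)
    have b6 := fun q => t (a6 q) (a7 q)
    have b5 := fun q => t (a5 q) (b6 q)
    have b4 := fun q => t (a4 q) (b5 q)
    have b3 := fun q => t (a3 q) (b4 q)
    have b2 := fun q => t (a2 q) (b3 q)
    have b1 := fun q => t (a1 q) (b2 q)
    have b0 := fun q => t (a0 q) (b1 q)
    refine main b0 ?_
    rintro ⟨_ | _, q⟩
    exacts [⟨_, b0 q⟩, ⟨_, b1 q⟩, ⟨_, b2 q⟩, ⟨_, b3 q⟩, ⟨_, b4 q⟩, ⟨_, b5 q⟩, ⟨_, b6 q⟩, ⟨_, a7 q⟩]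
  · have hr : ∀ j, r j (be Q j) := hr
    have a0 : ∀ q, r (.e0, q) (.e6, q) := fun q => hr (.e0, q)
    have a1 : ∀ q, r (.e1, q) (.e0, q + 1) := fun q => hr (.e1, q)
    have a2 : ∀ q, r (.e2, q) (.e5, q - 1) := fun q => hr (.e2, q)
    have a3 : ∀ q, r (.e3, q) (.e7, q - 1) := fun q => hr (.e3, q)
    have a4 : ∀ q, r (.e4, q) (.e3, q + 1) := fun q => hr (.e4, q)
    have a5 : ∀ q, r (.e5, q) (.e1, q) := fun q => hr (.e5, q)
    have a6 : ∀ q, r (.e6, q) (.e4, q + 1) := fun q => hr (.e6, q)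
    have a7 : ∀ q, r (.e7, q) (.e2, q) := fun q => hr (.e7, q)
    have b5 := fun q => t (a5 q) (a1 q)
    have b2 := fun q => t (a2 q) (b5 _)
    have b7 := fun q => t (a7 q) (b2 _)
    have b3 := fun q => t (a3 q) (b7 _)
    have b4 := fun q => t (a4 q) (b3 _)
    have b6 := fun q => t (a6 q) (b4 _)
    have b0 := fun q => t (a0 q) (b6 _)
    refine main (fun q => by simpa using b0 q) ?_
    rintro ⟨_ | _, q⟩
    exacts [⟨_, b0 q⟩, ⟨_, a1 q⟩, ⟨_, b2 q⟩, ⟨_, b3 q⟩, ⟨_, b4 q⟩, ⟨_, b5 q⟩, ⟨_, b6 q⟩, ⟨_, b7 q⟩]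

/-- Crossing labels for opposite signs. -/
def Y2 : E8 × Q → Fin 4 × Q
  | (.e0, q) => (0, q)
  | (.e1, q) => (1, q)
  | (.e2, q) => (2, q - 1)
  | (.e3, q) => (3, q - 1)
  | (.e4, q) => (2, q)
  | (.e5, q) => (0, q)
  | (.e6, q) => (3, q)
  | (.e7, q) => (1, q)

/-- Crossing labels for equal signs. -/
def Y1 : E8 × Q → (Bool × Q) ⊕ Bool
  | (.e0, _) => .inr false
  | (.e1, q) => .inl (false, q - 1)
  | (.e2, q) => .inl (true, q - 1)
  | (.e3, _) => .inr true
  | (.e4, q) => .inl (false, q - 1)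
  | (.e5, q) => .inl (false, q)
  | (.e6, q) => .inl (true, q - 1)
  | (.e7, q) => .inl (true, q)

theorem cross2 (n1 : (1 : Q) ≠ 0) :
    Cross (hs (gg Q) (fun c => !c)) (fun c j => bif c then Y2 j else Y2 ((al Q).symm j)) := by
  apply mkCross (hs (gg Q) (fun c => !c)) Y2
  · rintro ⟨_ | _, q⟩ <;> simp [hs, gg, al, be, Y2]
  · rintro ⟨_ | _, q⟩ <;> simp [hs, gg, al, Y2]
  · rintro ⟨_ | _, q⟩ ⟨_ | _, q'⟩ <;> simp [hs, gg, al, Y2]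
  · rintro ⟨_ | _, q⟩ ⟨_ | _, q'⟩ <;> simp [hs, gg, al, Y2] <;> first
      | (exact fun h h' => n1 (by linear_combination h + h'))
      | (exact fun h h' => n1 (by linear_combination h - h'))
      | (exact fun h h' => n1 (by linear_combination h' - h))
      | (exact fun h h' => n1 (by linear_combination - h - h'))
  · intro r hr
    have hr : ∀ i, r i ((be Q).symm (al Q i)) := hr
    have a0 : ∀ q, r (.e0, q) (.e5, q) := fun q => by simpa [al, be] using hr (.e0, q)
    have a1 : ∀ q, r (.e1, q) (.e7, q) := fun q => by simpa [al, be] using hr (.e1, q)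
    have a2 : ∀ q, r (.e2, q) (.e4, q - 1) := fun q => by simpa [al, be] using hr (.e2, q)
    have a3 : ∀ q, r (.e3, q) (.e6, q - 1) := fun q => by simpa [al, be] using hr (.e3, q)
    have key : ∀ i, r i ((fun p : Fin 4 × Q => (![E8.e5, .e7, .e4, .e6] p.1, p.2)) (Y2 i)) := by
      rintro ⟨_ | _, q⟩ <;> simp [Y2]
      exacts [a0 q, a1 q, a2 q, a3 q]
    intro i i' e
    have := key i
    rw [e] at this
    exact r.trans this (r.symm (key i'))
  · rintro ⟨x, q⟩
    fin_cases x
    exacts [⟨(.e5, q), rfl⟩, ⟨(.e7, q), rfl⟩, ⟨(.e4, q), rfl⟩, ⟨(.e6, q), rfl⟩]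

theorem cross1 (hQ : Gen Q) (n1 : (1 : Q) ≠ 0) (n2 : (2 : Q) ≠ 0) :
    Cross (hs (gg Q) (fun _ => true)) (fun c j => bif c then Y1 j else Y1 ((al Q).symm j)) := by
  apply mkCross (hs (gg Q) (fun _ => true)) Y1
  · rintro ⟨_ | _, q⟩ <;> simp [hs, gg, al, be, Y1]
  · rintro ⟨_ | _, q⟩ <;> simp [hs, gg, al, Y1] <;> first
      | (exact fun h => n1 (by linear_combination h))
      | (exact fun h => n1 (by linear_combination - h))
  · rintro ⟨_ | _, q⟩ ⟨_ | _, q'⟩ <;> simp [hs, gg, al, Y1] <;> first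
      | (exact fun h h' => n1 (by linear_combination h + h'))
      | (exact fun h h' => n1 (by linear_combination h - h'))
      | (exact fun h h' => n1 (by linear_combination h' - h))
      | (exact fun h h' => n1 (by linear_combination - h - h'))
      | (exact fun h h' => n2 (by linear_combination h + h'))
      | (exact fun h h' => n2 (by linear_combination h - h'))
      | (exact fun h h' => n2 (by linear_combination h' - h))
      | (exact fun h h' => n2 (by linear_combination - h - h'))
      | (intro h h'; linear_combination h)
      | (intro h; linear_combination h)
  · rintro ⟨_ | _, q⟩ ⟨_ | _, q'⟩ <;> simp [hs, gg, al, Y1] <;> first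
      | (exact fun h h' => n1 (by linear_combination h + h'))
      | (exact fun h h' => n1 (by linear_combination h - h'))
      | (exact fun h h' => n1 (by linear_combination h' - h))
      | (exact fun h h' => n1 (by linear_combination - h - h'))
      | (exact fun h h' => n2 (by linear_combination h + h'))
      | (exact fun h h' => n2 (by linear_combination h - h'))
      | (exact fun h h' => n2 (by linear_combination h' - h))
      | (exact fun h h' => n2 (by linear_combination - h - h'))
      | (intro h h'; linear_combination h)
      | (intro h; linear_combination h)
  · intro r hr
    have hr : ∀ i, r i (be Q (al Q i)) := hr
    have a0 : ∀ q, r (.e0, q) (.e0, q + 1) := fun q => by simpa [al, be] using hr (.e0, q)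
    have a1 : ∀ q, r (.e1, q) (.e5, q - 1) := fun q => by simpa [al, be] using hr (.e1, q)
    have a2 : ∀ q, r (.e2, q) (.e7, q - 1) := fun q => by simpa [al, be] using hr (.e2, q)
    have a3 : ∀ q, r (.e3, q) (.e3, q + 1) := fun q => by simpa [al, be] using hr (.e3, q)
    have a4 : ∀ q, r (.e4, q) (.e1, q) := fun q => by simpa [al, be] using hr (.e4, q)
    have a6 : ∀ q, r (.e6, q) (.e2, q) := fun q => by simpa [al, be] using hr (.e6, q)
    have s0 : ∀ q, r (.e0, q) (.e0, 0) := fun q =>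
      hQ ⟨fun q q' => r (.e0, q) (.e0, q'), fun _ => r.refl _, fun h => r.symm h,
        fun h h' => r.trans h h'⟩ a0 q 0
    have s3 : ∀ q, r (.e3, q) (.e3, 0) := fun q =>
      hQ ⟨fun q q' => r (.e3, q) (.e3, q'), fun _ => r.refl _, fun h => r.symm h,
        fun h h' => r.trans h h'⟩ a3 q 0
    have key : ∀ i, r i (Sum.elim (fun p : Bool × Q => (bif p.1 then E8.e7 else .e5, p.2))
        (fun b => (bif b then E8.e3 else .e0, 0)) (Y1 i)) := by
      rintro ⟨_ | _, q⟩ <;> simp [Y1]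
      exacts [s0 q, a1 q, a2 q, s3 q, r.trans (a4 q) (a1 q), r.trans (a6 q) (a2 q)]
    intro i i' e
    have := key i
    rw [e] at this
    exact r.trans this (r.symm (key i'))
  · rintro (⟨_ | _, q⟩ | _ | _)
    exacts [⟨(.e5, q), rfl⟩, ⟨(.e7, q), rfl⟩, ⟨(.e0, 0), rfl⟩, ⟨(.e3, 0), rfl⟩]

end

theorem gen_zmod (m : ℕ) [NeZero m] : Gen (ZMod m) := by
  intro r hr
  have key : ∀ n : ℕ, r 0 (n : ZMod m) := by
    intro n
    induction n with
    | zero => simpa using r.refl _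
    | succ n ih => simpa using r.trans ih (hr _)
  have key' : ∀ q, r 0 q := fun q => by simpa using key q.val
  intro q q'
  exact r.trans (r.symm (key' q)) (key' q')

/-- In a polyhedral embedding the signs are constant on each half. -/
theorem sign_const {I W : Type} {g : Bool → Equiv.Perm I} {f : VV I ≃ W} {h : NoShort g}
    [Fintype W] [DecidableEq W] [Nonempty I] (hT : Trans g) (R : RotationSystem (gr g f h))
    (hP : R.Polyhedral) : ∃ s : Bool → Bool, HasSign g f h R (sg I s) := by
  obtain ⟨S, hS⟩ := exists_sign g f h R
  obtain ⟨j0⟩ := ‹Nonempty I›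
  have hp := sign_pent hS hP
  refine ⟨fun c => S (.u, c, j0), ?_⟩
  have hu : ∀ c j, S (.u, c, j) = S (.u, c, j0) := fun c j =>
    hT c ⟨fun j j' => S (.u, c, j) = S (.u, c, j'), fun _ => rfl, fun h => h.symm,
      fun h h' => h.trans h'⟩ (fun j => (hp c j).2.2.symm) j j0
  have : sg I (fun c => S (.u, c, j0)) = S := by
    funext ⟨κ, c, j⟩
    cases κ
    · exact (hu c j).symm
    · exact ((hp c j).2.1.trans (hu c j)).symm
    · exact ((hp c j).1.trans (hu c j)).symm
  rw [this]
  exact hS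

theorem hs_not {I : Type} (g : Bool → Equiv.Perm I) (s : Bool → Bool) :
    hs g (fun c => !(s c)) = fun c => (hs g s c).symm := by
  funext c
  cases hc : s c <;> simp [hs, hc]

end PG

/-- For every `k > 0` there is a cubic graph with two polyhedral embeddings whose
genera differ by at least `k`, and with no polyhedral embedding of any genus strictly
in between. -/
theorem polyhedral_genus_gap (k : ℕ) (hk : 0 < k) :
    ∃ (n : ℕ) (G : SimpleGraph (Fin n)) (R R' : RotationSystem G) (g g' : ℕ),
      G.IsCubic ∧ R.Polyhedral ∧ R'.Polyhedral ∧ R.HasGenus g ∧ R'.HasGenus g' ∧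
      g + k ≤ g' ∧
      ∀ (R'' : RotationSystem G) (g'' : ℕ), R''.Polyhedral → R''.HasGenus g'' →
        ¬ (g < g'' ∧ g'' < g') := by
  have : NeZero (k + 3) := ⟨by omega⟩
  have hQ := PG.gen_zmod (k + 3)
  have n1 : (1 : ZMod (k + 3)) ≠ 0 := by
    intro e
    have := (ZMod.natCast_eq_zero_iff 1 (k + 3)).1 (by exact_mod_cast e)
    have := Nat.le_of_dvd (by omega) this
    omega
  have n2 : (2 : ZMod (k + 3)) ≠ 0 := by
    intro e
    have := (ZMod.natCast_eq_zero_iff 2 (k + 3)).1 (by exact_mod_cast e)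
    have := Nat.le_of_dvd (by omega) this
    omega
  have hT := PG.gg_trans hQ
  have hc1 := PG.cross1 hQ n1 n2
  have hc2 := PG.cross2 (Q := ZMod (k + 3)) n1
  have : Fintype (PG.E8 × ZMod (k + 3)) := Fintype.ofFinite _
  let f := Fintype.equivFin (PG.VV (PG.E8 × ZMod (k + 3)))
  have cI : Nat.card (PG.E8 × ZMod (k + 3)) = 8 * (k + 3) := by
    rw [Nat.card_prod, Nat.card_congr PG.e8]
    simp
  have c1 : Nat.card ((Bool × ZMod (k + 3)) ⊕ Bool) = 2 * (k + 3) + 2 := by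
    rw [Nat.card_sum, Nat.card_prod]
    simp
  have c2 : Nat.card (Fin 4 × ZMod (k + 3)) = 4 * (k + 3) := by
    rw [Nat.card_prod]
    simp
  have hS1 := PG.RS_sign (PG.gg (ZMod (k + 3))) f PG.gg_short (PG.sg _ (fun _ => true))
  have hS2 := PG.RS_sign (PG.gg (ZMod (k + 3))) f PG.gg_short (PG.sg _ (fun c => !c))
  have cV := PG.card_verts f
  have cE := PG.card_edges (g := PG.gg (ZMod (k + 3))) (f := f) (h := PG.gg_short)
  have nF1 := PG.numFaces_eq hS1 hT hc1
  have nF2 := PG.numFaces_eq hS2 hT hc2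
  refine ⟨_, PG.gr (PG.gg (ZMod (k + 3))) f PG.gg_short, PG.RS _ _ _ _, PG.RS _ _ _ _,
    2 * (k + 3), 3 * k + 8, PG.cubic _ _ _, PG.poly hS2 hT hc2, PG.poly hS1 hT hc1, ?_, ?_,
    by omega, ?_⟩
  · rw [RotationSystem.HasGenus, nF2, cE, cV, cI, c2]
    push_cast
    ring
  · rw [RotationSystem.HasGenus, nF1, cE, cV, cI, c1]
    push_cast
    ring
  · intro R g'' hP hG
    obtain ⟨s, hS⟩ := PG.sign_const hT R hP
    have hn : R.numFaces = 2 * Nat.card (PG.E8 × ZMod (k + 3)) + 2 + (2 * (k + 3) + 2) ∨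
        R.numFaces = 2 * Nat.card (PG.E8 × ZMod (k + 3)) + 2 + 4 * (k + 3) := by
      have hm1 := hc1.mirror
      have hm2 := hc2.mirror
      rw [← PG.hs_not] at hm1 hm2
      have hs : s = (fun _ => true) ∨ s = (fun _ => !true) ∨ s = (fun c => !c) ∨
          s = (fun c => !!c) := by
        have all : ∀ s : Bool → Bool, s = (fun _ => true) ∨ s = (fun _ => !true) ∨
            s = (fun c => !c) ∨ s = (fun c => !!c) := by decide
        exact all s
      rcases hs with rfl | rfl | rfl | rfl
      · left; rw [PG.numFaces_eq hS hT hc1, c1]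
      · left; rw [PG.numFaces_eq hS hT hm1, c1]
      · right; rw [PG.numFaces_eq hS hT hc2, c2]
      · right; rw [PG.numFaces_eq hS hT hm2, c2]
    rw [RotationSystem.HasGenus, cE, cV] at hG
    rw [cI] at hG hn
    push_cast at hG
    omega
end

section
/- For every k > 0 there exist a cubic graph G and k distinct nonnegative integers g_1 < g_2 < … < g_k such that for each i, G has a polyhedral embedding of genus g_i. -/
open SimpleGraph

/-! The construction: a ring of `n` copies of a piece, namely the Dyck graph with two far apart
vertices removed.  The Dyck graph has a polyhedral embedding of genus `1` and one of genus `3`,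
with the same rotations at the two removed vertices, so that in every piece of the ring we can
choose independently which of the two embeddings is used.
-/

set_option linter.unusedSectionVars false

namespace PolyRing

/-- Half-edge structure: darts, tails and the inversion, giving a simple graph. -/
structure HE (D V : Type) where
  tail : D → V
  inv : D → D
  inv_inv : ∀ d, inv (inv d) = d
  no_loop : ∀ d, tail d ≠ tail (inv d)
  inj : ∀ d e, tail d = tail e → tail (inv d) = tail (inv e) → d = e

variable {D V : Type} [Fintype D] [DecidableEq D] [Fintype V] [DecidableEq V]

def HE.graph (H : HE D V) : SimpleGraph V where
  Adj u v := ∃ d, H.tail d = u ∧ H.tail (H.inv d) = v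
  symm := ⟨by
    rintro u v ⟨d, h1, h2⟩
    exact ⟨H.inv d, h2, by rw [H.inv_inv]; exact h1⟩⟩
  loopless := ⟨by
    rintro u ⟨d, h1, h2⟩
    exact H.no_loop d (h1.trans h2.symm)⟩

noncomputable def HE.dart (H : HE D V) : D ≃ H.graph.Dart :=
  Equiv.ofBijective (fun d => ⟨(H.tail d, H.tail (H.inv d)), ⟨d, rfl, rfl⟩⟩) (by
    constructor
    · intro d e h
      have h' := congrArg SimpleGraph.Dart.toProd h
      simp only [Prod.mk.injEq] at h'
      exact H.inj d e h'.1 h'.2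
    · rintro ⟨⟨u, v⟩, ⟨d, h1, h2⟩⟩
      refine ⟨d, ?_⟩
      apply SimpleGraph.Dart.ext
      simp only at h1 h2 ⊢
      rw [h1, h2])

theorem HE.dart_fst (H : HE D V) (d : D) : (H.dart d).fst = H.tail d := rfl

theorem HE.dart_symm (H : HE D V) (d : D) : (H.dart d).symm = H.dart (H.inv d) := by
  apply SimpleGraph.Dart.ext
  change (H.tail (H.inv d), H.tail d) = (H.tail (H.inv d), H.tail (H.inv (H.inv d)))
  rw [H.inv_inv]

/-- A rotation together with a certificate that its embedding is polyhedral. -/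
structure Cert (H : HE D V) (Λ : Type) where
  s : Equiv.Perm D
  tail_s : ∀ d, H.tail (s d) = H.tail d
  cub : ∀ d, s (s (s d)) = d
  ne : ∀ d, s d ≠ d
  orb : ∀ d e, H.tail d = H.tail e → e = d ∨ e = s d ∨ d = s e
  L : D → Λ
  rk : D → ℕ
  L_face : ∀ d, L (s (H.inv d)) = L d
  rk_face : ∀ d, rk d ≠ 0 → rk (s (H.inv d)) < rk d
  root : ∀ d e, rk d = 0 → rk e = 0 → L d = L e → d = e
  noloop : ∀ d, L d ≠ L (H.inv d)
  nomult : ∀ d e, L d = L e → L (H.inv d) = L (H.inv e) → d = e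

variable {Λ : Type} {H : HE D V}

noncomputable def Cert.rot (C : Cert H Λ) : RotationSystem H.graph where
  σ := H.dart.permCongr C.s
  tail_fixed := by
    intro d
    obtain ⟨d, rfl⟩ := H.dart.surjective d
    simp [Equiv.permCongr_apply, HE.dart_fst, C.tail_s]
  orbit_tail := by
    intro d e h
    obtain ⟨d, rfl⟩ := H.dart.surjective d
    obtain ⟨e, rfl⟩ := H.dart.surjective e
    rw [HE.dart_fst, HE.dart_fst] at h
    rcases C.orb d e h with h | h | h
    · rw [h]
    · refine ⟨1, ?_⟩
      simp [Equiv.permCongr_apply, h]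
    · refine ⟨-1, ?_⟩
      rw [zpow_neg, zpow_one, Equiv.Perm.inv_eq_iff_eq]
      simp [Equiv.permCongr_apply, h]

theorem Cert.faceMap_dart (C : Cert H Λ) (d : D) :
    C.rot.faceMap (H.dart d) = H.dart (C.s (H.inv d)) := by
  change (H.dart.permCongr C.s) ((H.dart d).symm) = _
  rw [HE.dart_symm, Equiv.permCongr_apply, Equiv.symm_apply_apply]

theorem Cert.to_root (C : Cert H Λ) : ∀ (m : ℕ) (d : D), C.rk d = m →
    ∃ e, C.rk e = 0 ∧ C.L e = C.L d ∧ C.rot.SameFace (H.dart d) (H.dart e) := by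
  intro m
  induction m using Nat.strong_induction_on with
  | _ m ih =>
    intro d hd
    by_cases h0 : C.rk d = 0
    · exact ⟨d, h0, rfl, Equiv.Perm.SameCycle.refl _ _⟩
    · have hlt := C.rk_face d h0
      obtain ⟨e, he, hL, hs⟩ := ih _ (hd ▸ hlt) (C.s (H.inv d)) rfl
      refine ⟨e, he, hL.trans (C.L_face d), ?_⟩
      rw [← C.faceMap_dart] at hs
      exact Equiv.Perm.sameCycle_apply_left.1 hs

theorem Cert.L_of_same (C : Cert H Λ) (a b : H.graph.Dart) (h : C.rot.SameFace a b) :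
    C.L (H.dart.symm a) = C.L (H.dart.symm b) := by
  have step : ∀ a, C.L (H.dart.symm (C.rot.faceMap a)) = C.L (H.dart.symm a) := by
    intro a
    obtain ⟨d, rfl⟩ := H.dart.surjective a
    rw [C.faceMap_dart, Equiv.symm_apply_apply, Equiv.symm_apply_apply, C.L_face]
  have stepn : ∀ (j : ℕ) a, C.L (H.dart.symm ((C.rot.faceMap ^ j) a)) = C.L (H.dart.symm a) := by
    intro j
    induction j with
    | zero => intro a; simp
    | succ j ih => intro a; rw [pow_succ, Equiv.Perm.mul_apply, ih, step]
  obtain ⟨i, hi⟩ := h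
  obtain ⟨j, rfl | rfl⟩ := i.eq_nat_or_neg
  · rw [← hi, zpow_natCast, stepn]
  · rw [zpow_neg, zpow_natCast, Equiv.Perm.inv_eq_iff_eq] at hi
    rw [hi, stepn]

theorem Cert.same_iff (C : Cert H Λ) (d e : D) :
    C.rot.SameFace (H.dart d) (H.dart e) ↔ C.L d = C.L e := by
  constructor
  · intro h
    have := C.L_of_same _ _ h
    simpa using this
  · intro h
    obtain ⟨r, hr, hL, hs⟩ := C.to_root _ d rfl
    obtain ⟨r', hr', hL', hs'⟩ := C.to_root _ e rfl
    have : r = r' := C.root r r' hr hr' (by rw [hL, hL', h])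
    subst this
    exact Equiv.Perm.SameCycle.trans hs (Equiv.Perm.SameCycle.symm hs')

theorem Cert.numFaces_eq (C : Cert H Λ) :
    C.rot.numFaces = Nat.card {d : D // C.rk d = 0} := by
  symm
  apply Nat.card_congr
  refine Equiv.ofBijective (fun d => Quot.mk _ (H.dart d.1)) ⟨?_, ?_⟩
  · rintro ⟨d, hd⟩ ⟨e, he⟩ h
    have h' : C.L (H.dart.symm (H.dart d)) = C.L (H.dart.symm (H.dart e)) :=
      congrArg (Quot.lift (fun a => C.L (H.dart.symm a)) (fun a b hab => C.L_of_same a b hab)) h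
    rw [Equiv.symm_apply_apply, Equiv.symm_apply_apply] at h'
    exact Subtype.ext (C.root d e hd he h')
  · intro x
    induction x using Quot.ind with
    | mk a =>
      obtain ⟨d, rfl⟩ := H.dart.surjective a
      obtain ⟨r, hr, hL, hs⟩ := C.to_root _ d rfl
      exact ⟨⟨r, hr⟩, (Quot.sound hs).symm⟩

theorem Cert.L_s (C : Cert H Λ) (d : D) : C.L (C.s d) = C.L (H.inv d) := by
  have := C.L_face (H.inv d)
  rwa [H.inv_inv] at this

/-- A vertex common to two distinct faces lies on a common edge. -/
theorem Cert.shared (C : Cert H Λ) (d e : D) (ht : H.tail d = H.tail e) (hL : C.L d ≠ C.L e) :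
    ∃ a, C.L a = C.L d ∧ C.L (H.inv a) = C.L e ∧ (H.tail d = H.tail a ∨
      H.tail d = H.tail (H.inv a)) := by
  rcases C.orb d e ht with h | h | h
  · exact absurd (by rw [h]) hL
  · exact ⟨d, rfl, by rw [h, C.L_s], Or.inl rfl⟩
  · refine ⟨H.inv e, ?_, by rw [H.inv_inv], Or.inr (by rw [H.inv_inv, ht])⟩
    rw [h, C.L_s]

theorem Cert.mem_verts (C : Cert H Λ) (d : D) (v : V) :
    v ∈ C.rot.faceVerts (H.dart d) ↔ ∃ e, C.L d = C.L e ∧ H.tail e = v := by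
  constructor
  · rintro ⟨e, h1, h2⟩
    obtain ⟨e, rfl⟩ := H.dart.surjective e
    exact ⟨e, (C.same_iff d e).1 h1, h2⟩
  · rintro ⟨e, h1, h2⟩
    exact ⟨H.dart e, (C.same_iff d e).2 h1, h2⟩

theorem Cert.mem_edges (C : Cert H Λ) (d : D) (x : Sym2 V) :
    x ∈ C.rot.faceEdges (H.dart d) ↔
      ∃ e, C.L d = C.L e ∧ s(H.tail e, H.tail (H.inv e)) = x := by
  constructor
  · rintro ⟨e, h1, h2⟩
    obtain ⟨e, rfl⟩ := H.dart.surjective e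
    exact ⟨e, (C.same_iff d e).1 h1, h2⟩
  · rintro ⟨e, h1, h2⟩
    exact ⟨H.dart e, (C.same_iff d e).2 h1, h2⟩

theorem Cert.polyhedral (C : Cert H Λ) : C.rot.Polyhedral := by
  constructor
  · intro d e hs ht
    obtain ⟨d, rfl⟩ := H.dart.surjective d
    obtain ⟨e, rfl⟩ := H.dart.surjective e
    rw [C.same_iff] at hs
    rw [HE.dart_fst, HE.dart_fst] at ht
    rcases C.orb d e ht with h | h | h
    · rw [h]
    · rw [h, C.L_s] at hs
      exact absurd hs (C.noloop d)
    · rw [h, C.L_s] at hs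
      exact absurd hs.symm (C.noloop e)
  · intro d e hs
    obtain ⟨d, rfl⟩ := H.dart.surjective d
    obtain ⟨e, rfl⟩ := H.dart.surjective e
    rw [C.same_iff] at hs
    by_cases hemp : C.rot.faceVerts (H.dart d) ∩ C.rot.faceVerts (H.dart e) = ∅
    · exact Or.inl hemp
    right; right
    obtain ⟨v, hv1, hv2⟩ := Set.nonempty_iff_ne_empty.2 hemp
    rw [C.mem_verts] at hv1 hv2
    obtain ⟨d1, hd1, rfl⟩ := hv1
    obtain ⟨e1, he1, ht1⟩ := hv2
    obtain ⟨a, ha1, ha2, -⟩ := C.shared d1 e1 ht1.symm (by rw [← hd1, ← he1]; exact hs)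
    rw [← hd1] at ha1
    rw [← he1] at ha2
    refine ⟨H.tail a, H.tail (H.inv a), ⟨a, rfl, rfl⟩, ?_, ?_⟩
    · ext v
      simp only [Set.mem_inter_iff, C.mem_verts, Set.mem_insert_iff, Set.mem_singleton_iff]
      constructor
      · rintro ⟨⟨d2, hd2, rfl⟩, ⟨e2, he2, ht2⟩⟩
        obtain ⟨b, hb1, hb2, hb⟩ := C.shared d2 e2 ht2.symm (by rw [← hd2, ← he2]; exact hs)
        have : b = a := C.nomult b a (by rw [hb1, ← hd2, ha1]) (by rw [hb2, ← he2, ha2])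
        rwa [this] at hb
      · rintro (rfl | rfl)
        · refine ⟨⟨a, ha1.symm, rfl⟩, ⟨C.s a, ?_, C.tail_s a⟩⟩
          rw [C.L_s, ha2]
        · refine ⟨⟨C.s (H.inv a), ?_, C.tail_s _⟩, ⟨H.inv a, ha2.symm, rfl⟩⟩
          rw [C.L_face, ha1]
    · ext x
      simp only [Set.mem_inter_iff, C.mem_edges, Set.mem_singleton_iff]
      constructor
      · rintro ⟨⟨d2, hd2, rfl⟩, ⟨e2, he2, ht2⟩⟩
        rw [Sym2.eq_iff] at ht2
        rcases ht2 with ⟨h1, h2⟩ | ⟨h1, h2⟩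
        · have : e2 = d2 := H.inj _ _ h1 h2
          subst this
          exact absurd (hd2.trans he2.symm) hs
        · have h3 : e2 = H.inv d2 := H.inj _ _ h1 (by rw [H.inv_inv]; exact h2)
          have : d2 = a := C.nomult d2 a (by rw [← hd2, ha1]) (by rw [← h3, ← he2, ha2])
          rw [this]
      · rintro rfl
        refine ⟨⟨a, ha1.symm, rfl⟩, ⟨H.inv a, ha2.symm, ?_⟩⟩
        rw [H.inv_inv, Sym2.eq_swap]

theorem Cert.cubic (C : Cert H Λ) (hsurj : Function.Surjective H.tail) : H.graph.IsCubic := by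
  intro v
  obtain ⟨d, rfl⟩ := hsurj v
  have key : ∀ a b, H.tail a = H.tail b → a ≠ b → H.tail (H.inv a) ≠ H.tail (H.inv b) :=
    fun a b h hab h' => hab (H.inj a b h h')
  have h2 : C.s (C.s d) ≠ d := by
    intro h
    have := C.cub d
    rw [h] at this
    exact C.ne d this
  rw [Nat.card_coe_set_eq, Set.ncard_eq_three]
  refine ⟨H.tail (H.inv d), H.tail (H.inv (C.s d)), H.tail (H.inv (C.s (C.s d))),
    key _ _ (C.tail_s d).symm (C.ne d).symm,
    key _ _ (by rw [C.tail_s, C.tail_s]) h2.symm,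
    key _ _ (C.tail_s _).symm (C.ne _).symm, ?_⟩
  ext w
  simp only [SimpleGraph.mem_neighborSet, Set.mem_insert_iff, Set.mem_singleton_iff]
  constructor
  · rintro ⟨e, h1, rfl⟩
    rcases C.orb d e h1.symm with h | h | h
    · left; rw [h]
    · right; left; rw [h]
    · right; right
      rw [h, C.cub]
  · rintro (rfl | rfl | rfl)
    · exact ⟨d, rfl, rfl⟩
    · exact ⟨_, C.tail_s d, rfl⟩
    · exact ⟨C.s (C.s d), by rw [C.tail_s, C.tail_s], rfl⟩

theorem HE.two_edges (H : HE D V) : Fintype.card D = 2 * Nat.card H.graph.edgeSet := by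
  classical
  rw [Fintype.card_congr H.dart, SimpleGraph.dart_card_eq_twice_card_edges,
    Nat.card_eq_fintype_card, SimpleGraph.edgeFinset_card]

/-! ### The local data -/

/-- Table lookup, eight bits per entry. -/
def tab (T x : ℕ) : ℕ := (T >>> (8 * x)) % 256

def opp (x : ℕ) : ℕ := tab 1838281827370767462792802023184615358370098738596981733206151708229589856283650211310360902336610752588432649902155744937717691001672786132404471331716559458669317262174192919961475315548141396382778896920808988289795 x

def de (x : ℕ) : ℕ := tab 21545846700484980435554494163806838909391042827445066298941306523202513190896710810390528190594458259340783568664940494186670888879782064565860588808721890493452324625430827299611574457576882465650360594088253784065 x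

def fl (x : ℕ) : ℕ := tab 21630007585660835480347555428114418008457698600542969754566688491774775700638633405937482358426848322754536233820343070129775355989782343100346103378782666972013620119513951370473181722940230537334976786470304547073 x

def lb (s : Bool) (x : ℕ) : ℕ :=
  tab (bif s then 43175855570397949816216159853465922085372682774457966048291650102279013492832621568696668789305077494190993527229910246132749350030209584508366342717910781708334493075535248498619680217229847198647785456361881534976
    else 43178156919947185155109919311975480399699744013640331921234712256178516882004115777038149250933676677908165140743321281603909557095065782624999468668273551255935401811526798889524087321448692834703616461799707116035) x

def ep (s : Bool) (x : ℕ) : ℕ :=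
  tab (bif s then 21545517936974676853088502189397689770178753336422138008510186873953905908865128308562966782644935959212514007574924492393809815808452427565219718700195279812917243371361704750581933642038247741383535487399523057664
    else 328763529975660760368257055446250206835053366150608109734225255996673486734222533663822879995751033611237000855328959678904368196864295743876084083476503684232132853006328534580139574479150354812065452103041025) x

def rk (s : Bool) (x : ℕ) : ℕ :=
  tab (bif s then 495633374759784966030994918710804024657744372695344192929380980599207044952575873240979001935169198236333865334661093733035616432770323014628806428539194959764183334523114988145502236947598161902164092639788226117895
    else 107812408107494291917781809356204977470126684524936669261390012083384007483936367479577626039936629319974583301114918693619345332420774184507366554639176535101071423892829024871439540446912577303675635244398882914560) x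

def sg (s : Bool) (x : ℕ) : ℕ := 3 * (x / 3) + (x % 3 + 1 + (bif s then fl x else 0)) % 3

theorem opp_lt : ∀ x : Fin 90, opp x < 90 := by decide +kernel

theorem sg_lt (s : Bool) (x : Fin 90) : sg s x < 90 := by
  unfold sg
  omega

def oppF (x : Fin 90) : Fin 90 := ⟨opp x, opp_lt x⟩

def sgF (s : Bool) (x : Fin 90) : Fin 90 := ⟨sg s x, sg_lt s x⟩

theorem opp_opp : ∀ x : Fin 90, opp (opp x) = x := by decide +kernel

theorem de_le : ∀ x : Fin 90, de x ≤ 2 := by decide +kernel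

theorem de_de : ∀ x : Fin 90, de x + de (opp x) = 2 := by decide +kernel

theorem ep_le : ∀ (s : Bool) (x : Fin 90), ep s x ≤ 1 := by decide +kernel

theorem loc_loop : ∀ x : Fin 90, x.val / 3 ≠ opp x / 3 := by decide +kernel

theorem loc_inj : ∀ x y : Fin 90, x.val / 3 = y.val / 3 → opp x / 3 = opp y / 3 → x = y := by
  decide +kernel

theorem sg_cub : ∀ (s : Bool) (x : Fin 90), sg s (sg s (sg s x)) = x := by decide +kernel

theorem sg_ne : ∀ (s : Bool) (x : Fin 90), sg s x ≠ x := by decide +kernel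

theorem sg_orb : ∀ (s : Bool) (x y : Fin 90), x.val / 3 = y.val / 3 →
    y = x ∨ y.val = sg s x ∨ x.val = sg s y := by decide +kernel

theorem loc_face : ∀ (s t : Bool) (x : Fin 90), (de x = 1 → s = t) →
    lb t (sg t (opp x)) = lb s x ∧ de x + ep t (sg t (opp x)) = ep s x + 1 := by decide +kernel

theorem loc_rk : ∀ (s t : Bool) (x : Fin 90), (de x = 1 → s = t) → rk s x ≠ 0 →
    rk t (sg t (opp x)) < rk s x := by decide +kernel

theorem loc_rk_ep : ∀ (s : Bool) (x : Fin 90), rk s x = 0 → ep s x = 1 := by decide +kernel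

theorem loc_root : ∀ (s : Bool) (x y : Fin 90), rk s x = 0 → rk s y = 0 → lb s x = lb s y →
    x = y := by decide +kernel

theorem loc_noloop : ∀ (s t : Bool) (x : Fin 90), (de x = 1 → s = t) →
    lb t (opp x) = lb s x → de x + ep t (opp x) ≠ ep s x + 1 := by decide +kernel

set_option synthInstance.maxSize 2000 in
set_option synthInstance.maxHeartbeats 400000 in
theorem loc_nomult : ∀ (x y : Fin 90) (s s' : Bool), lb s x = lb s' y →
    (ep s x = ep s' y → s = s') → ∀ t t' : Bool, lb t (opp x) = lb t' (opp y) →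
    (de x = 1 → s = t) → (de y = 1 → s' = t') →
    de x + ep t (opp x) + ep s' y = ep s x + de y + ep t' (opp y) →
    x = y ∧ ep s x = ep s' y := by decide +kernel

theorem count_rk (s : Bool) : Fintype.card {x : Fin 90 // rk s x = 0} = bif s then 9 else 13 := by
  rw [Fintype.card_subtype]
  revert s
  decide +kernel


/-! ### The ring -/

theorem small_cast {n : ℕ} (hn : 10 ≤ n) (a b : ℕ) (ha : a < 10) (hb : b < 10)
    (h : (a : ZMod n) = (b : ZMod n)) : a = b := by
  rw [ZMod.natCast_eq_natCast_iff] at h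
  exact Nat.ModEq.eq_of_lt_of_lt h (by omega) (by omega)

def third (x : Fin 90) : Fin 30 := ⟨x.val / 3, by omega⟩

/-- Neighbouring piece in which the inverse of a dart lies. -/
def nxt {n : ℕ} (c : ZMod n) (x : Fin 90) : ZMod n := c + (de x : ZMod n) - 1

theorem nxt_eq {n : ℕ} (c : ZMod n) (x : Fin 90) (h : de x = 1) : nxt c x = c := by
  simp [nxt, h]

/-- The half-edges of the ring of `n` pieces. -/
def ringHE (n : ℕ) (W : Type) (e : ZMod n × Fin 30 ≃ W) : HE (ZMod n × Fin 90) W where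
  tail d := e (d.1, third d.2)
  inv d := (nxt d.1 d.2, oppF d.2)
  inv_inv := by
    rintro ⟨c, x⟩
    have h : (de x : ZMod n) + (de (opp x) : ZMod n) = 2 := by
      exact_mod_cast congrArg (Nat.cast : ℕ → ZMod n) (de_de x)
    refine Prod.ext ?_ (Fin.ext (opp_opp x))
    change c + (de x : ZMod n) - 1 + (de (opp x) : ZMod n) - 1 = c
    linear_combination h
  no_loop := by
    rintro ⟨c, x⟩ h
    have h' := e.injective h
    simp only [Prod.mk.injEq] at h'
    exact loc_loop x (congrArg Fin.val h'.2)
  inj := by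
    rintro ⟨c, x⟩ ⟨c', y⟩ h1 h2
    have h1' := e.injective h1
    have h2' := e.injective h2
    simp only [Prod.mk.injEq] at h1' h2'
    exact Prod.ext h1'.1 (loc_inj x y (congrArg Fin.val h1'.2) (congrArg Fin.val h2'.2))

/-- The rotation which uses the embedding `st c` in the piece `c`. -/
def ringRot {n : ℕ} (st : ZMod n → Bool) : Equiv.Perm (ZMod n × Fin 90) where
  toFun d := (d.1, sgF (st d.1) d.2)
  invFun d := (d.1, sgF (st d.1) (sgF (st d.1) d.2))
  left_inv := by
    rintro ⟨c, x⟩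
    exact Prod.ext rfl (Fin.ext (sg_cub (st c) x))
  right_inv := by
    rintro ⟨c, x⟩
    exact Prod.ext rfl (Fin.ext (sg_cub (st c) x))

def ringCert {n : ℕ} (hn : 10 ≤ n) {W : Type} (e : ZMod n × Fin 30 ≃ W) (st : ZMod n → Bool) :
    Cert (ringHE n W e) (ZMod n × ℕ) where
  s := ringRot st
  tail_s := by
    rintro ⟨c, x⟩
    change e (c, third (sgF (st c) x)) = e (c, third x)
    congr 2
    apply Fin.ext
    change (3 * (x.val / 3) + _ % 3) / 3 = x.val / 3
    omega
  cub := by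
    rintro ⟨c, x⟩
    exact Prod.ext rfl (Fin.ext (sg_cub (st c) x))
  ne := by
    rintro ⟨c, x⟩ h
    exact sg_ne (st c) x (congrArg (fun d : ZMod n × Fin 90 => d.2.val) h)
  orb := by
    rintro ⟨c, x⟩ ⟨c', y⟩ h
    have h' := e.injective h
    simp only [Prod.mk.injEq] at h'
    obtain ⟨rfl, h2⟩ := h'
    rcases sg_orb (st c) x y (congrArg Fin.val h2) with h | h | h
    · exact Or.inl (by rw [h])
    · exact Or.inr (Or.inl (Prod.ext rfl (Fin.ext h)))
    · exact Or.inr (Or.inr (Prod.ext rfl (Fin.ext h)))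
  L d := (d.1 + (ep (st d.1) d.2 : ZMod n), lb (st d.1) d.2)
  rk d := rk (st d.1) d.2
  L_face := by
    rintro ⟨c, x⟩
    obtain ⟨h1, h2⟩ := loc_face (st c) (st (nxt c x)) x (fun h => by rw [nxt_eq c x h])
    refine Prod.ext ?_ h1
    have h := congrArg (Nat.cast : ℕ → ZMod n) h2
    push_cast at h
    change c + (de x : ZMod n) - 1 + (ep (st (nxt c x)) (sg (st (nxt c x)) (opp x)) : ZMod n) =
      c + (ep (st c) x : ZMod n)
    linear_combination h
  rk_face := by
    rintro ⟨c, x⟩ h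
    exact loc_rk (st c) (st (nxt c x)) x (fun h => by rw [nxt_eq c x h]) h
  root := by
    rintro ⟨c, x⟩ ⟨c', y⟩ h1 h2 h
    simp only [Prod.mk.injEq] at h1 h2 h
    obtain ⟨h3, h4⟩ := h
    rw [loc_rk_ep _ _ h1, loc_rk_ep _ _ h2] at h3
    have : c = c' := add_right_cancel h3
    subst this
    exact Prod.ext rfl (loc_root (st c) x y h1 h2 h4)
  noloop := by
    rintro ⟨c, x⟩ h
    have h1 : c + (ep (st c) x : ZMod n) =
      c + (de x : ZMod n) - 1 + (ep (st (nxt c x)) (opp x) : ZMod n) := congrArg Prod.fst h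
    have h2 : lb (st c) x = lb (st (nxt c x)) (opp x) := congrArg Prod.snd h
    refine loc_noloop (st c) (st (nxt c x)) x (fun h => by rw [nxt_eq c x h]) h2.symm ?_
    have b1 := de_le x
    have b2 := ep_le (st c) x
    have b3 : ep (st (nxt c x)) (opp x) ≤ 1 := ep_le (st (nxt c x)) (oppF x)
    apply small_cast hn _ _ (by omega) (by omega)
    push_cast
    linear_combination -h1
  nomult := by
    rintro ⟨c, x⟩ ⟨c', y⟩ h h'
    have h1 : c + (ep (st c) x : ZMod n) = c' + (ep (st c') y : ZMod n) := congrArg Prod.fst h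
    have h2 : lb (st c) x = lb (st c') y := congrArg Prod.snd h
    have h3 : c + (de x : ZMod n) - 1 + (ep (st (nxt c x)) (opp x) : ZMod n) =
      c' + (de y : ZMod n) - 1 + (ep (st (nxt c' y)) (opp y) : ZMod n) := congrArg Prod.fst h'
    have h4 : lb (st (nxt c x)) (opp x) = lb (st (nxt c' y)) (opp y) := congrArg Prod.snd h'
    have hc : ep (st c) x = ep (st c') y → c = c' := by
      intro h5
      rw [h5] at h1
      exact add_right_cancel h1
    have b1 := de_le x
    have b2 := de_le y
    have b3 := ep_le (st c) x
    have b4 := ep_le (st c') y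
    have b5 : ep (st (nxt c x)) (opp x) ≤ 1 := ep_le (st (nxt c x)) (oppF x)
    have b6 : ep (st (nxt c' y)) (opp y) ≤ 1 := ep_le (st (nxt c' y)) (oppF y)
    obtain ⟨h6, h7⟩ := loc_nomult x y (st c) (st c') h2 (fun h5 => by rw [hc h5])
      (st (nxt c x)) (st (nxt c' y)) h4 (fun h => by rw [nxt_eq c x h])
      (fun h => by rw [nxt_eq c' y h]) (by
        apply small_cast hn _ _ (by omega) (by omega)
        push_cast
        linear_combination h3 - h1)
    exact Prod.ext (hc h7) h6

theorem ring_faces {n : ℕ} [NeZero n] (hn : 10 ≤ n) {W : Type} [Fintype W] [DecidableEq W]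
    (e : ZMod n × Fin 30 ≃ W) (S : Finset (ZMod n)) :
    (ringCert hn e (fun c => decide (c ∈ S))).rot.numFaces + 4 * S.card = 13 * n := by
  have h0 : Nat.card {d : ZMod n × Fin 90 // rk (decide (d.1 ∈ S)) d.2 = 0}
      = ∑ c : ZMod n, if c ∈ S then 9 else 13 := by
    have eq : {d : ZMod n × Fin 90 // rk (decide (d.1 ∈ S)) d.2 = 0} ≃
        (Σ c : ZMod n, {x : Fin 90 // rk (decide (c ∈ S)) x = 0}) :=
      { toFun := fun d => ⟨d.1.1, d.1.2, d.2⟩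
        invFun := fun d => ⟨(d.1, d.2.1), d.2.2⟩
        left_inv := fun d => rfl
        right_inv := fun d => rfl }
    rw [Nat.card_congr eq, Nat.card_eq_fintype_card, Fintype.card_sigma]
    refine Finset.sum_congr rfl fun c _ => ?_
    rw [count_rk]
    by_cases h : c ∈ S <;> simp [h]
  rw [Cert.numFaces_eq]
  change Nat.card {d : ZMod n × Fin 90 // rk (decide (d.1 ∈ S)) d.2 = 0} + _ = _
  have h1 : (∑ c : ZMod n, if c ∈ S then 4 else 0) = 4 * S.card := by
    simp [mul_comm]
  rw [h0, ← h1, ← Finset.sum_add_distrib]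
  have h2 : ∀ c : ZMod n, ((if c ∈ S then 9 else 13) + if c ∈ S then 4 else 0) = 13 := by
    intro c
    by_cases h : c ∈ S <;> simp [h]
  rw [Finset.sum_congr rfl (fun c _ => h2 c)]
  simp [ZMod.card, mul_comm]

end PolyRing

/-- For every `k > 0` there is a cubic graph having polyhedral embeddings in at least
`k` distinct genera. -/
theorem polyhedral_in_many_genera (k : ℕ) (hk : 0 < k) :
    ∃ (n : ℕ) (G : SimpleGraph (Fin n)) (gs : Fin k → ℕ),
      G.IsCubic ∧ StrictMono gs ∧
      ∀ i : Fin k, ∃ R : RotationSystem G, R.Polyhedral ∧ R.HasGenus (gs i) := by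
  have hn : 10 ≤ k + 10 := by omega
  have : NeZero (k + 10) := ⟨by omega⟩
  have e : ZMod (k + 10) × Fin 30 ≃ Fin ((k + 10) * 30) :=
    Fintype.equivFinOfCardEq (by simp [ZMod.card])
  have hE : (k + 10) * 90 = 2 * Nat.card (PolyRing.ringHE (k + 10) _ e).graph.edgeSet := by
    rw [← PolyRing.HE.two_edges]
    simp [ZMod.card]
  refine ⟨(k + 10) * 30, (PolyRing.ringHE (k + 10) _ e).graph, fun i => k + 11 + 2 * i.val,
    ?_, ?_, ?_⟩
  · apply (PolyRing.ringCert hn e (fun _ => false)).cubic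
    intro v
    obtain ⟨⟨c, x⟩, rfl⟩ := e.surjective v
    refine ⟨(c, ⟨3 * x.val, by omega⟩), ?_⟩
    change e (c, _) = _
    congr 2
    apply Fin.ext
    change 3 * x.val / 3 = x.val
    omega
  · intro i j h
    have : i.val < j.val := h
    change k + 11 + 2 * i.val < k + 11 + 2 * j.val
    omega
  · intro i
    obtain ⟨S, -, hS⟩ := Finset.exists_subset_card_eq (s := (Finset.univ : Finset (ZMod (k + 10))))
      (n := i.val) (by rw [Finset.card_univ, ZMod.card]; omega)
    have hF := PolyRing.ring_faces hn e S
    refine ⟨(PolyRing.ringCert hn e (fun c => decide (c ∈ S))).rot,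
      PolyRing.Cert.polyhedral _, ?_⟩
    unfold RotationSystem.HasGenus
    rw [Fintype.card_fin]
    rw [hS] at hF
    push_cast
    omega
end
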